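/- arXiv:2503.08995 — 10 statements merged into one kernel-verified Lean document; each statement's English description precedes it below -/
import Mathlib

section
/- Let G be a group acting by isometries on a metric space X, properly discontinuously relative to a finite collection of subgroups 𝓗, let S ⊆ G be a finite subset such that G is generated by S ∪ ⋃_{H∈𝓗} H, and fix a base point x* ∈ X. Then there exists a non-decreasing function Λ : ℝ≥0 → ℕ such that for every x ∈ X and every g ∈ G, ℓ_{S,𝓗}(g) ≤ Λ(2·d(x*, x) + d(x, g·x)). -/
open scoped Pointwise

/-- The set `S ∪ S⁻¹ ∪ ⋃_{H ∈ 𝓗} H` of "relative generators". -/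
def relGenSet {G : Type*} [Group G] (S : Finset G) (𝓗 : Set (Subgroup G)) : Set G :=
  (S : Set G) ∪ (S : Set G)⁻¹ ∪ ⋃ H ∈ 𝓗, (H : Set G)

/-- A subset `V ⊆ G` has finite diameter relative to `𝓗` if there are a finite `S ⊆ G` and
`n : ℕ` such that for all `v, w ∈ V`, the element `v⁻¹ * w` is a product of at most `n`
elements of `S ∪ S⁻¹ ∪ ⋃_{H ∈ 𝓗} H`. -/
def FinRelDiam {G : Type*} [Group G] (𝓗 : Set (Subgroup G)) (V : Set G) : Prop :=
  ∃ (S : Finset G) (n : ℕ), ∀ v ∈ V, ∀ w ∈ V,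
    ∃ l : List G, l.length ≤ n ∧ (∀ x ∈ l, x ∈ relGenSet S 𝓗) ∧ l.prod = v⁻¹ * w

/-- The action of `G` on `X` is properly discontinuous relative to `𝓗` if for every bounded
open `U ⊆ X`, the set `{g : G | U ∩ g • U ≠ ∅}` has finite diameter relative to `𝓗`. -/
def RelPropDisc (G X : Type*) [Group G] [MetricSpace X] [MulAction G X]
    (𝓗 : Set (Subgroup G)) : Prop :=
  ∀ U : Set X, IsOpen U → Bornology.IsBounded U →
    FinRelDiam 𝓗 {g : G | (U ∩ g • U).Nonempty}

/-- The action of `G` on `X` is cocompact: there is a compact `K ⊆ X` with `G • K = X`. -/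
def CocompactAction (G X : Type*) [Group G] [MetricSpace X] [MulAction G X] : Prop :=
  ∃ K : Set X, IsCompact K ∧ (⋃ g : G, g • K) = Set.univ

/-- The action of `G` on `X` is geometric relative to `𝓗`: properly discontinuous relative to
`𝓗`, cocompact, and every `H ∈ 𝓗` has a nonempty fixed-point set. -/
def RelGeometric (G X : Type*) [Group G] [MetricSpace X] [MulAction G X]
    (𝓗 : Set (Subgroup G)) : Prop :=
  RelPropDisc G X 𝓗 ∧ CocompactAction G X ∧
    ∀ H ∈ 𝓗, ({x : X | ∀ h ∈ H, h • x = x}).Nonempty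

/-- A geodesic metric space: any two points are joined by an isometric embedding of
`[0, d(x,y)]` sending the endpoints to `x` and `y`. -/
def IsGeodesicSpace (X : Type*) [MetricSpace X] : Prop :=
  ∀ x y : X, ∃ γ : ℝ → X, γ 0 = x ∧ γ (dist x y) = y ∧
    ∀ s ∈ Set.Icc (0 : ℝ) (dist x y), ∀ t ∈ Set.Icc (0 : ℝ) (dist x y),
      dist (γ s) (γ t) = |s - t|

open scoped ENNReal NNReal

/-- The relative word length `ℓ_{S,𝓗}(g)`: the least `n` such that `g` is a product of `n`
elements of `S ∪ S⁻¹ ∪ ⋃_{H ∈ 𝓗} H`, and `∞` if no such expression exists. -/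
noncomputable def relWordLength {G : Type*} [Group G] (S : Finset G) (𝓗 : Set (Subgroup G))
    (g : G) : ℝ≥0∞ :=
  ⨅ l : {l : List G // (∀ x ∈ l, x ∈ relGenSet S 𝓗) ∧ l.prod = g}, (l.1.length : ℝ≥0∞)

section RelWordLength

variable {G : Type*} [Group G] {S : Finset G} {𝓗 : Set (Subgroup G)}

theorem inv_mem_relGenSet {g : G} (hg : g ∈ relGenSet S 𝓗) : g⁻¹ ∈ relGenSet S 𝓗 := by
  simp only [relGenSet, Set.mem_union, Set.mem_inv, Set.mem_iUnion, SetLike.mem_coe,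
    inv_inv, inv_mem_iff] at hg ⊢
  tauto

theorem relWordLength_prod_le {l : List G} (hl : ∀ x ∈ l, x ∈ relGenSet S 𝓗) :
    relWordLength S 𝓗 l.prod ≤ l.length :=
  iInf_le (fun l' : {l' : List G // (∀ x ∈ l', x ∈ relGenSet S 𝓗) ∧ l'.prod = l.prod} ↦
    (l'.1.length : ℝ≥0∞)) ⟨l, hl, rfl⟩

theorem relWordLength_le_one {g : G} (hg : g ∈ relGenSet S 𝓗) : relWordLength S 𝓗 g ≤ 1 := by
  simpa using relWordLength_prod_le (l := [g]) (by simpa using hg)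

theorem relWordLength_one : relWordLength S 𝓗 1 = 0 := by
  simpa using relWordLength_prod_le (S := S) (𝓗 := 𝓗) (l := []) (by simp)

theorem relWordLength_mul_le (g h : G) :
    relWordLength S 𝓗 (g * h) ≤ relWordLength S 𝓗 g + relWordLength S 𝓗 h := by
  conv_rhs => rw [relWordLength, relWordLength]
  simp_rw [ENNReal.iInf_add, ENNReal.add_iInf]
  refine le_iInf fun l ↦ le_iInf fun m ↦ ?_
  obtain ⟨l, hl, rfl⟩ := l
  obtain ⟨m, hm, rfl⟩ := m
  have := relWordLength_prod_le (S := S) (𝓗 := 𝓗) (l := l ++ m)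
    fun x hx ↦ (List.mem_append.1 hx).elim (hl x) (hm x)
  simpa using this

theorem relWordLength_inv_le (g : G) : relWordLength S 𝓗 g⁻¹ ≤ relWordLength S 𝓗 g := by
  conv_rhs => rw [relWordLength]
  refine le_iInf fun l ↦ ?_
  obtain ⟨l, hl, rfl⟩ := l
  have := relWordLength_prod_le (S := S) (𝓗 := 𝓗) (l := (l.map (·⁻¹)).reverse) fun x hx ↦ by
    obtain ⟨y, hy, rfl⟩ := List.mem_map.1 (List.mem_reverse.1 hx)
    exact inv_mem_relGenSet (hl y hy)
  simpa [List.prod_inv_reverse] using this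

theorem relWordLength_ne_top (hgen : Subgroup.closure ((S : Set G) ∪ ⋃ H ∈ 𝓗, (H : Set G)) = ⊤)
    (g : G) : relWordLength S 𝓗 g ≠ ∞ := by
  have hg : g ∈ Subgroup.closure ((S : Set G) ∪ ⋃ H ∈ 𝓗, (H : Set G)) :=
    hgen ▸ Subgroup.mem_top g
  induction hg using Subgroup.closure_induction with
  | mem x hx =>
    exact ne_top_of_le_ne_top ENNReal.one_ne_top
      (relWordLength_le_one (Set.union_subset_union_left _ Set.subset_union_left hx))
  | one => simp [relWordLength_one]
  | mul x y _ _ hx hy =>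
    exact ne_top_of_le_ne_top (ENNReal.add_ne_top.2 ⟨hx, hy⟩) (relWordLength_mul_le x y)
  | inv x _ hx => exact ne_top_of_le_ne_top hx (relWordLength_inv_le x)

theorem relWordLength_prod_le_length_mul {M : ℝ≥0∞} {l : List G}
    (hl : ∀ x ∈ l, relWordLength S 𝓗 x ≤ M) : relWordLength S 𝓗 l.prod ≤ l.length * M := by
  induction l with
  | nil => simp [relWordLength_one]
  | cons a l ih =>
    rw [List.forall_mem_cons] at hl
    rw [List.prod_cons, List.length_cons, Nat.cast_succ, add_mul, one_mul, add_comm]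
    exact (relWordLength_mul_le _ _).trans (add_le_add hl.1 (ih hl.2))

/-- Relative word lengths with respect to a finite relative generating set are bounded on every
set of finite relative diameter which contains the identity. -/
theorem FinRelDiam.exists_relWordLength_le {V : Set G} (hV : FinRelDiam 𝓗 V) (h1 : (1 : G) ∈ V)
    (hgen : Subgroup.closure ((S : Set G) ∪ ⋃ H ∈ 𝓗, (H : Set G)) = ⊤) :
    ∃ N : ℕ, ∀ g ∈ V, relWordLength S 𝓗 g ≤ N := by
  obtain ⟨T, n, hT⟩ := hV
  set M : ℝ≥0∞ := 1 + ∑ t ∈ T, relWordLength S 𝓗 t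
  have hMtop : M ≠ ∞ := ENNReal.add_ne_top.2
    ⟨ENNReal.one_ne_top, ENNReal.sum_ne_top.2 fun t _ ↦ relWordLength_ne_top hgen t⟩
  have hTM : ∀ t ∈ T, relWordLength S 𝓗 t ≤ M := fun t ht ↦
    (Finset.single_le_sum (f := relWordLength S 𝓗) (fun _ _ ↦ zero_le) ht).trans le_add_self
  have hgenM : ∀ x ∈ relGenSet T 𝓗, relWordLength S 𝓗 x ≤ M := by
    rintro x ((hx | hx) | hx)
    · exact hTM x hx
    · simpa using (relWordLength_inv_le x⁻¹).trans (hTM x⁻¹ hx)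
    · exact (relWordLength_le_one (Or.inr hx)).trans le_self_add
  obtain ⟨N, hN⟩ := ENNReal.exists_nat_gt (ENNReal.mul_ne_top (ENNReal.natCast_ne_top n) hMtop)
  refine ⟨N, fun g hg ↦ ?_⟩
  obtain ⟨l, hln, hl, hprod⟩ := hT 1 h1 g hg
  rw [inv_one, one_mul] at hprod
  rw [← hprod]
  calc relWordLength S 𝓗 l.prod ≤ l.length * M :=
        relWordLength_prod_le_length_mul fun x hx ↦ hgenM x (hl x hx)
    _ ≤ n * M := by gcongr
    _ ≤ N := hN.le

end RelWordLength

theorem dist_smul_le_two_mul_dist_add {G X : Type*} [Group G] [MetricSpace X] [MulAction G X]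
    {g : G} (hg : Isometry (fun x : X => g • x)) (x₀ x : X) :
    dist x₀ (g • x₀) ≤ 2 * dist x₀ x + dist x (g • x) := by
  have h := dist_triangle4 x₀ x (g • x) (g • x₀)
  have hxx₀ : dist (g • x) (g • x₀) = dist x x₀ := hg.dist_eq x x₀
  rw [hxx₀, dist_comm x x₀] at h
  linarith

/-- Lemma 2.10: if the `G`-action on `X` is properly discontinuous relative to `𝓗`, `S` is a
finite relative generating set and `x₀ ∈ X` a base point, then there is a non-decreasing
`Λ : ℝ≥0 → ℕ` such that `ℓ_{S,𝓗}(g) ≤ Λ(2·d(x₀,x) + d(x,g•x))` for all `x ∈ X`, `g ∈ G`. -/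
theorem relWordLength_le_of_relPropDisc {G X : Type*} [Group G] [MetricSpace X]
    [MulAction G X] (hisom : ∀ g : G, Isometry (fun x : X => g • x))
    (𝓗 : Finset (Subgroup G))
    (hpd : RelPropDisc G X (↑𝓗 : Set (Subgroup G)))
    (S : Finset G)
    (hgen : Subgroup.closure ((S : Set G) ∪ ⋃ H ∈ 𝓗, (H : Set G)) = ⊤)
    (x₀ : X) :
    ∃ Λ : ℝ≥0 → ℕ, Monotone Λ ∧ ∀ (x : X) (g : G),
      relWordLength S (↑𝓗) g ≤
        (Λ (Real.toNNReal (2 * dist x₀ x + dist x (g • x))) : ℝ≥0∞) := by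
  have hbound (n : ℕ) : ∃ N : ℕ, ∀ g : G, dist x₀ (g • x₀) < n + 1 →
      relWordLength S (↑𝓗) g ≤ N := by
    have hx₀ : x₀ ∈ Metric.ball x₀ (n + 1 : ℝ) := Metric.mem_ball_self (by positivity)
    obtain ⟨N, hN⟩ := (hpd _ Metric.isOpen_ball Metric.isBounded_ball).exists_relWordLength_le
      (S := S) ⟨x₀, hx₀, by simpa using hx₀⟩ (by simpa using hgen)
    exact ⟨N, fun g hg ↦ hN g
      ⟨g • x₀, Metric.mem_ball'.2 hg, Set.smul_mem_smul_set hx₀⟩⟩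
  choose N hN using hbound
  refine ⟨fun r ↦ ∑ i ∈ Finset.range (⌊r⌋₊ + 1), N i, fun r s hrs ↦ ?_, fun x g ↦ ?_⟩
  · exact Finset.sum_le_sum_of_subset
      (Finset.range_mono (Nat.succ_le_succ (Nat.floor_mono hrs)))
  · set r := Real.toNNReal (2 * dist x₀ x + dist x (g • x))
    have hlt : dist x₀ (g • x₀) < (⌊r⌋₊ : ℝ) + 1 :=
      calc dist x₀ (g • x₀) ≤ 2 * dist x₀ x + dist x (g • x) :=
            dist_smul_le_two_mul_dist_add (hisom g) x₀ x
        _ ≤ r := Real.le_coe_toNNReal _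
        _ < (⌊r⌋₊ : ℝ) + 1 := mod_cast Nat.lt_floor_add_one r
    refine (hN _ g hlt).trans (Nat.cast_le.2 ?_)
    exact Finset.single_le_sum (f := N) (fun _ _ ↦ Nat.zero_le _) (Finset.self_mem_range_succ _)
end

section
/- Let X be a metric space, E ≥ 1, C > 0, and let γ be a geodesic bicombing on X satisfying: (1) for all x, y1, y2 ∈ X and a, b, c ∈ [0,1], setting y1' = γ(x,y1)(a) and y2' = γ(x,y2)(b), d(γ(x,y1)(ca), γ(x,y2)(cb)) ≤ c·E·d(y1',y2') + C; and (2) for all x1, x2, y ∈ X and a, c ∈ [0,1], setting y' = γ(x1,y)(a), d(γ(x1,y)(ca), γ(x2,y')(c)) ≤ (1−c)·E·d(x1,x2) + C. Then γ is an (E, 2C)-geodesic coarsely convex bicombing. -/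
/-- A geodesic bicombing on a metric space `X`: a map `γ : X × X × [0,1] → X` with
`γ(x,y)(0) = x`, `γ(x,y)(1) = y` and `d(γ(x,y)(t), γ(x,y)(s)) = |t−s|·d(x,y)`. -/
def IsGeodesicBicombing {X : Type*} [MetricSpace X] (γ : X → X → ℝ → X) : Prop :=
  ∀ x y : X, γ x y 0 = x ∧ γ x y 1 = y ∧
    ∀ t ∈ Set.Icc (0 : ℝ) 1, ∀ s ∈ Set.Icc (0 : ℝ) 1,
      dist (γ x y t) (γ x y s) = |t - s| * dist x y

/-- An `(E,C)`-geodesic coarsely convex bicombing: a geodesic bicombing satisfying the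
coarse convexity inequality. -/
def IsGCCBicombing {X : Type*} [MetricSpace X] (E C : ℝ) (γ : X → X → ℝ → X) : Prop :=
  IsGeodesicBicombing γ ∧
  ∀ (x₁ x₂ y₁ y₂ : X), ∀ a ∈ Set.Icc (0 : ℝ) 1, ∀ b ∈ Set.Icc (0 : ℝ) 1,
    ∀ c ∈ Set.Icc (0 : ℝ) 1,
      dist (γ x₁ y₁ (c * a)) (γ x₂ y₂ (c * b)) ≤
        (1 - c) * E * dist x₁ x₂ + c * E * dist (γ x₁ y₁ a) (γ x₂ y₂ b) + C

/-- Lemma 3.10: if a geodesic bicombing satisfies the two one-sided coarse convexity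
conditions, then it is an `(E, 2C)`-geodesic coarsely convex bicombing. -/
theorem isGCCBicombing_of_one_sided {X : Type*} [MetricSpace X] (E C : ℝ)
    (hE : 1 ≤ E) (hC : 0 < C) (γ : X → X → ℝ → X)
    (hγ : IsGeodesicBicombing γ)
    (h1 : ∀ (x y₁ y₂ : X), ∀ a ∈ Set.Icc (0 : ℝ) 1, ∀ b ∈ Set.Icc (0 : ℝ) 1,
      ∀ c ∈ Set.Icc (0 : ℝ) 1,
        dist (γ x y₁ (c * a)) (γ x y₂ (c * b)) ≤
          c * E * dist (γ x y₁ a) (γ x y₂ b) + C)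
    (h2 : ∀ (x₁ x₂ y : X), ∀ a ∈ Set.Icc (0 : ℝ) 1, ∀ c ∈ Set.Icc (0 : ℝ) 1,
        dist (γ x₁ y (c * a)) (γ x₂ (γ x₁ y a) c) ≤
          (1 - c) * E * dist x₁ x₂ + C) :
    IsGCCBicombing E (2 * C) γ := by
  refine ⟨hγ, fun x₁ x₂ y₁ y₂ a ha b hb c hc => ?_⟩
  have near := h2 x₁ x₂ y₁ a ha c hc
  have far := h1 x₂ (γ x₁ y₁ a) y₂ 1 ⟨zero_le_one, le_rfl⟩ b hb c hc
  rw [mul_one, (hγ x₂ (γ x₁ y₁ a)).2.1] at far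
  linarith [dist_triangle (γ x₁ y₁ (c * a)) (γ x₂ (γ x₁ y₁ a) c) (γ x₂ y₂ (c * b))]
end

section
/- Let X be a metric space, E ≥ 1, C ≥ 0, K ≥ 0, and let γ be a geodesic bicombing on X which is K-coarsely consistent, (E,C)-coarsely forward convex, and (E,C)-coarsely backward convex. Then γ is an (E, 2C + 4K)-geodesic coarsely convex bicombing. -/
/-- A geodesic bicombing `γ` is `K`-coarsely consistent if for all `x, y` and `a ∈ [0,1]`,
setting `z = γ(x,y)(a)`, one has `d(γ(x,z)(c), γ(x,y)(ca)) ≤ K` for all `c ∈ [0,1]`. -/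
def CoarselyConsistent {X : Type*} [MetricSpace X] (K : ℝ) (γ : X → X → ℝ → X) : Prop :=
  ∀ x y : X, ∀ a ∈ Set.Icc (0 : ℝ) 1, ∀ c ∈ Set.Icc (0 : ℝ) 1,
    dist (γ x (γ x y a) c) (γ x y (c * a)) ≤ K

/-- `(E,C)`-coarse forward convexity. -/
def CoarselyForwardConvex {X : Type*} [MetricSpace X] (E C : ℝ) (γ : X → X → ℝ → X) : Prop :=
  ∀ v w₁ w₂ : X, ∀ c ∈ Set.Icc (0 : ℝ) 1,
    dist (γ v w₁ c) (γ v w₂ c) ≤ c * E * dist w₁ w₂ + C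

/-- `(E,C)`-coarse backward convexity. -/
def CoarselyBackwardConvex {X : Type*} [MetricSpace X] (E C : ℝ) (γ : X → X → ℝ → X) : Prop :=
  ∀ v₁ v₂ w : X, ∀ c ∈ Set.Icc (0 : ℝ) 1,
    dist (γ v₁ w c) (γ v₂ w c) ≤ (1 - c) * E * dist v₁ v₂ + C

/-- Proposition 3.13: a geodesic bicombing which is `K`-coarsely consistent,
`(E,C)`-coarsely forward convex and `(E,C)`-coarsely backward convex is an
`(E, 2C + 4K)`-geodesic coarsely convex bicombing. -/
theorem isGCCBicombing_of_consistent_forward_backward {X : Type*} [MetricSpace X]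
    (E C K : ℝ) (hE : 1 ≤ E) (hC : 0 ≤ C) (hK : 0 ≤ K) (γ : X → X → ℝ → X)
    (hγ : IsGeodesicBicombing γ)
    (hcon : CoarselyConsistent K γ)
    (hfwd : CoarselyForwardConvex E C γ)
    (hbwd : CoarselyBackwardConvex E C γ) :
    IsGCCBicombing E (2 * C + 4 * K) γ := by
  refine ⟨hγ, fun x₁ x₂ y₁ y₂ a ha b hb c hc => ?_⟩
  have h₁ := hcon x₁ y₁ a ha c hc
  have h₂ := hfwd x₁ (γ x₁ y₁ a) (γ x₂ y₂ b) c hc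
  have h₃ := hbwd x₁ x₂ (γ x₂ y₂ b) c hc
  have h₄ := hcon x₂ y₂ b hb c hc
  rw [dist_comm] at h₁
  have t₁ := dist_triangle4 (γ x₁ y₁ (c * a)) (γ x₁ (γ x₁ y₁ a) c)
    (γ x₁ (γ x₂ y₂ b) c) (γ x₂ y₂ (c * b))
  have t₂ := dist_triangle (γ x₁ (γ x₂ y₂ b) c) (γ x₂ (γ x₂ y₂ b) c) (γ x₂ y₂ (c * b))
  linarith
end

section
/- Let Z be a metric space with a geodesic bicombing Γ, and let C ≥ 0, D ≥ 0, E ≥ 1. If Γ is coarsely (C,D,E)-forward thin, then there exist E* ≥ 1 and C* ≥ 0, depending only on C, D, E, such that Γ is (E*,C*)-coarsely forward convex: d(Γ(v,w1)(c), Γ(v,w2)(c)) ≤ c·E*·d(w1,w2) + C* for all v, w1, w2 ∈ Z and c ∈ [0,1]. -/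
/-- Two geodesics (parametrized on `[0,1]`) coarsely `D`-fellow travel: endpoints are
`D`-close and the Hausdorff distance between their images is at most `D`. -/
def FellowTravel {Z : Type*} [MetricSpace Z] (D : ℝ) (γ δ : ℝ → Z) : Prop :=
  dist (γ 0) (δ 0) ≤ D ∧ dist (γ 1) (δ 1) ≤ D ∧
    Metric.hausdorffDist (γ '' Set.Icc (0 : ℝ) 1) (δ '' Set.Icc (0 : ℝ) 1) ≤ D

/-- The subset `X ⊆ Z` is closed under `Γ` and the restriction of `Γ` to `X` satisfies the
`(E,C)`-geodesic coarse convexity inequality. -/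
def IsGCCOn {Z : Type*} [MetricSpace Z] (E C : ℝ) (Γ : Z → Z → ℝ → Z) (X : Set Z) : Prop :=
  (∀ p ∈ X, ∀ q ∈ X, ∀ t ∈ Set.Icc (0 : ℝ) 1, Γ p q t ∈ X) ∧
  ∀ x₁ ∈ X, ∀ x₂ ∈ X, ∀ y₁ ∈ X, ∀ y₂ ∈ X, ∀ a ∈ Set.Icc (0 : ℝ) 1,
    ∀ b ∈ Set.Icc (0 : ℝ) 1, ∀ c ∈ Set.Icc (0 : ℝ) 1,
      dist (Γ x₁ y₁ (c * a)) (Γ x₂ y₂ (c * b)) ≤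
        (1 - c) * E * dist x₁ x₂ + c * E * dist (Γ x₁ y₁ a) (Γ x₂ y₂ b) + C

/-- Definition 4.3: `Γ` is coarsely `(C,D,E)`-forward thin. -/
def CoarselyForwardThin {Z : Type*} [MetricSpace Z] (C D E : ℝ)
    (Γ : Z → Z → ℝ → Z) : Prop :=
  ∀ v w₁ w₂ : Z, 2 * D < min (dist v w₁) (dist v w₂) →
    ∃ (X : Set Z) (c₀ c₁ c₀' c₁' : ℝ),
      IsGCCOn E C Γ X ∧
      0 ≤ c₀ ∧ c₀ ≤ c₁ ∧ c₁ ≤ 1 ∧ 0 ≤ c₀' ∧ c₀' ≤ c₁' ∧ c₁' ≤ 1 ∧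
      Γ v w₁ c₀ ∈ X ∧ Γ v w₁ c₁ ∈ X ∧ Γ v w₂ c₀' ∈ X ∧ Γ v w₂ c₁' ∈ X ∧
      FellowTravel D (fun t => Γ v w₁ (c₀ * t)) (fun t => Γ v w₂ (c₀' * t)) ∧
      dist (Γ v w₁ c₁) (Γ v w₂ c₁') ≤
        max c₁ c₁' * dist (Γ v w₁ 1) (Γ v w₂ 1) + 4 * D ∧
      (∀ u ∈ Set.Icc (0 : ℝ) 1,
        Γ v w₁ (c₀ + u * (c₁ - c₀)) = Γ (Γ v w₁ c₀) (Γ v w₁ c₁) u ∧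
        Γ v w₂ (c₀' + u * (c₁' - c₀')) = Γ (Γ v w₂ c₀') (Γ v w₂ c₁') u) ∧
      dist (Γ v w₁ 1) (Γ v w₁ c₁) + dist (Γ v w₁ c₁) (Γ v w₂ c₁') +
          dist (Γ v w₂ c₁') (Γ v w₂ 1) ≤
        dist (Γ v w₁ 1) (Γ v w₂ 1) + 4 * D

/-- Definition 4.4: `Γ` is coarsely `(C,D,E)`-backward thin. -/
def CoarselyBackwardThin {Z : Type*} [MetricSpace Z] (C D E : ℝ)
    (Γ : Z → Z → ℝ → Z) : Prop :=
  ∀ v₁ v₂ w : Z, 2 * D < min (dist v₁ w) (dist v₂ w) →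
    ∃ (X : Set Z) (c₀ c₁ c₀' c₁' : ℝ),
      IsGCCOn E C Γ X ∧
      0 ≤ c₀ ∧ c₀ ≤ c₁ ∧ c₁ ≤ 1 ∧ 0 ≤ c₀' ∧ c₀' ≤ c₁' ∧ c₁' ≤ 1 ∧
      Γ v₁ w c₀ ∈ X ∧ Γ v₁ w c₁ ∈ X ∧ Γ v₂ w c₀' ∈ X ∧ Γ v₂ w c₁' ∈ X ∧
      FellowTravel D (fun t => Γ v₁ w (c₁ + t * (1 - c₁)))
        (fun t => Γ v₂ w (c₁' + t * (1 - c₁'))) ∧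
      dist (Γ v₁ w c₀) (Γ v₂ w c₀') ≤
        max (1 - c₀) (1 - c₀') * dist (Γ v₁ w 0) (Γ v₂ w 0) + 4 * D ∧
      (∀ u ∈ Set.Icc (0 : ℝ) 1,
        Γ v₁ w (c₀ + u * (c₁ - c₀)) = Γ (Γ v₁ w c₀) (Γ v₁ w c₁) u ∧
        Γ v₂ w (c₀' + u * (c₁' - c₀')) = Γ (Γ v₂ w c₀') (Γ v₂ w c₁') u) ∧
      dist (Γ v₁ w 0) (Γ v₁ w c₀) + dist (Γ v₁ w c₀) (Γ v₂ w c₀') +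
          dist (Γ v₂ w c₀') (Γ v₂ w 0) ≤
        dist (Γ v₁ w 0) (Γ v₂ w 0) + 4 * D

/-- `f` is a constant speed geodesic on `[0,1]` of length `L`. -/
def IsConstSpeedGeodesic {Z : Type*} [MetricSpace Z] (f : ℝ → Z) (L : ℝ) : Prop :=
  ∀ t ∈ Set.Icc (0 : ℝ) 1, ∀ s ∈ Set.Icc (0 : ℝ) 1, dist (f t) (f s) = |t - s| * L

namespace IsConstSpeedGeodesic

variable {Z : Type*} [MetricSpace Z] {f g : ℝ → Z} {L M : ℝ}

lemma dist_of_le (hf : IsConstSpeedGeodesic f L) {s t : ℝ} (hs : 0 ≤ s) (hst : s ≤ t)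
    (ht : t ≤ 1) : dist (f s) (f t) = (t - s) * L := by
  rw [hf s ⟨hs, hst.trans ht⟩ t ⟨hs.trans hst, ht⟩, abs_sub_comm,
    abs_of_nonneg (sub_nonneg.2 hst)]

lemma dist_zero (hf : IsConstSpeedGeodesic f L) {t : ℝ} (ht₀ : 0 ≤ t) (ht₁ : t ≤ 1) :
    dist (f 0) (f t) = t * L := by
  rw [hf.dist_of_le le_rfl ht₀ ht₁, sub_zero]

lemma length_nonneg (hf : IsConstSpeedGeodesic f L) : 0 ≤ L := by
  have h := hf.dist_zero zero_le_one le_rfl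
  rw [one_mul] at h
  exact h ▸ dist_nonneg

lemma abs_arclength_sub_le (hf : IsConstSpeedGeodesic f L) (hg : IsConstSpeedGeodesic g M)
    (h₀ : f 0 = g 0) {s t : ℝ} (hs₀ : 0 ≤ s) (hs₁ : s ≤ 1) (ht₀ : 0 ≤ t) (ht₁ : t ≤ 1) :
    |s * L - t * M| ≤ dist (f s) (g t) := by
  rw [← hf.dist_zero hs₀ hs₁, ← hg.dist_zero ht₀ ht₁, h₀]
  simpa only [dist_comm (g 0)] using abs_dist_sub_le (f s) (g t) (g 0)

lemma abs_length_sub_le (hf : IsConstSpeedGeodesic f L) (hg : IsConstSpeedGeodesic g M)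
    (h₀ : f 0 = g 0) : |L - M| ≤ dist (f 1) (g 1) := by
  simpa using hf.abs_arclength_sub_le hg h₀ zero_le_one le_rfl zero_le_one le_rfl

lemma dist_le_mul_add (hf : IsConstSpeedGeodesic f L) (hg : IsConstSpeedGeodesic g M)
    (h₀ : f 0 = g 0) {c : ℝ} (hc₀ : 0 ≤ c) (hc₁ : c ≤ 1) :
    dist (f c) (g c) ≤ c * (L + M) := by
  have h := dist_triangle_left (f c) (g c) (f 0)
  have hf' := hf.dist_zero hc₀ hc₁
  have hg' := hg.dist_zero hc₀ hc₁
  rw [← h₀] at hg'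
  linarith

/-- A geodesic issuing from the same point as a short geodesic stays close to it. -/
lemma dist_le_of_short (hf : IsConstSpeedGeodesic f L) (hg : IsConstSpeedGeodesic g M)
    (h₀ : f 0 = g 0) {K c : ℝ} (hK : 0 ≤ K) (hL : L ≤ 2 * dist (f 1) (g 1) + K)
    (hc₀ : 0 ≤ c) (hc₁ : c ≤ 1) :
    dist (f c) (g c) ≤ c * (5 * dist (f 1) (g 1)) + 2 * K := by
  have h := hf.dist_le_mul_add hg h₀ hc₀ hc₁
  have hLM := abs_le.1 (hf.abs_length_sub_le hg h₀)
  nlinarith [mul_le_mul_of_nonneg_left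
    (show L + M ≤ 5 * dist (f 1) (g 1) + 2 * K by linarith) hc₀,
    mul_nonneg hK (sub_nonneg.2 hc₁)]

lemma isBounded_image (hf : IsConstSpeedGeodesic f L) :
    Bornology.IsBounded (f '' Set.Icc (0 : ℝ) 1) := by
  refine (Metric.isBounded_closedBall (x := f 0) (r := L)).subset ?_
  rintro _ ⟨t, ht, rfl⟩
  rw [Metric.mem_closedBall, dist_comm, hf.dist_zero ht.1 ht.2]
  nlinarith [mul_nonneg (sub_nonneg.2 ht.2) hf.length_nonneg]

lemma comp_mul (hf : IsConstSpeedGeodesic f L) {a : ℝ} (ha₀ : 0 ≤ a) (ha₁ : a ≤ 1) :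
    IsConstSpeedGeodesic (fun t => f (a * t)) (a * L) := by
  intro t ht s hs
  rw [hf (a * t) ⟨mul_nonneg ha₀ ht.1, mul_le_one₀ ha₁ ht.1 ht.2⟩
    (a * s) ⟨mul_nonneg ha₀ hs.1, mul_le_one₀ ha₁ hs.1 hs.2⟩,
    ← mul_sub, abs_mul, abs_of_nonneg ha₀]
  ring

/-- Divergence at time `c` while the first geodesic is in its fellow travelling part. -/
lemma dist_le_of_fellowTravel (hf : IsConstSpeedGeodesic f L)
    (hg : IsConstSpeedGeodesic g M) (h₀ : f 0 = g 0) {D a b c : ℝ}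
    (ha₁ : a ≤ 1) (hb₀ : 0 ≤ b) (hb₁ : b ≤ 1)
    (hfg : FellowTravel D (fun t => f (a * t)) (fun t => g (b * t)))
    (hc₀ : 0 ≤ c) (hca : c ≤ a) :
    dist (f c) (g c) ≤ c * dist (f 1) (g 1) + (2 * D + 2) := by
  have ha₀ := hc₀.trans hca
  have hc₁ := hca.trans ha₁
  have hne : (Set.Icc (0 : ℝ) 1).Nonempty := ⟨0, by simp⟩
  have hmem : f c ∈ (fun t => f (a * t)) '' Set.Icc (0 : ℝ) 1 := by
    rcases ha₀.eq_or_lt with rfl | ha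
    · exact ⟨0, by simp, by simp [le_antisymm hca hc₀]⟩
    · refine ⟨c / a, ⟨by positivity, (div_le_one ha).2 hca⟩, ?_⟩
      simp only [mul_div_cancel₀ _ ha.ne']
  obtain ⟨_, ⟨τ, hτ, rfl⟩, hdist⟩ := Metric.exists_dist_lt_of_hausdorffDist_lt hmem
    (hfg.2.2.trans_lt (lt_add_one D))
    (Metric.hausdorffEDist_ne_top_of_nonempty_of_bounded (hne.image _) (hne.image _)
      (hf.comp_mul ha₀ ha₁).isBounded_image (hg.comp_mul hb₀ hb₁).isBounded_image)
  simp only at hdist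
  have hs₀ : 0 ≤ b * τ := mul_nonneg hb₀ hτ.1
  have hs₁ : b * τ ≤ 1 := mul_le_one₀ hb₁ hτ.1 hτ.2
  have harc := hf.abs_arclength_sub_le hg h₀ hc₀ hc₁ hs₀ hs₁
  have hlen := hf.abs_length_sub_le hg h₀
  have hgap : dist (g (b * τ)) (g c) ≤ D + 1 + c * dist (f 1) (g 1) := by
    have habs : |b * τ - c| * M = |(b * τ - c) * M| := by
      rw [abs_mul, abs_of_nonneg hg.length_nonneg]
    rw [hg _ ⟨hs₀, hs₁⟩ _ ⟨hc₀, hc₁⟩, habs]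
    have hsplit : (b * τ - c) * M = -(c * L - b * τ * M) + c * (L - M) := by ring
    rw [hsplit]
    refine (abs_add_le _ _).trans ?_
    rw [abs_neg, abs_mul, abs_of_nonneg hc₀]
    have := mul_le_mul_of_nonneg_left hlen hc₀
    linarith
  have := dist_triangle (f c) (g (b * τ)) (g c)
  linarith

/-- Divergence at a time `c ≥ 1/2` after the first geodesic has come close to its endpoint. -/
lemma dist_le_of_late (hf : IsConstSpeedGeodesic f L) (hg : IsConstSpeedGeodesic g M)
    (h₀ : f 0 = g 0) {K a c : ℝ} (hK : (1 - a) * L ≤ dist (f 1) (g 1) + K)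
    (ha : 1 / 2 ≤ a) (hac : a ≤ c) (hc₁ : c ≤ 1) :
    dist (f c) (g c) ≤ c * (8 * dist (f 1) (g 1)) + 2 * K := by
  have hc₀ : 0 ≤ c := by linarith
  have hfc := hf.dist_of_le hc₀ hc₁ le_rfl
  have hgc := hg.dist_of_le hc₀ hc₁ le_rfl
  have hlen := abs_le.1 (hf.abs_length_sub_le hg h₀)
  have htri := dist_triangle4 (f c) (f 1) (g 1) (g c)
  rw [dist_comm (g 1), hfc, hgc] at htri
  have hd : 0 ≤ dist (f 1) (g 1) := dist_nonneg
  nlinarith [mul_le_mul_of_nonneg_right hac hf.length_nonneg,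
    mul_le_mul_of_nonneg_left (show M ≤ L + dist (f 1) (g 1) by linarith)
      (sub_nonneg.2 hc₁), mul_nonneg (show 0 ≤ c - 1 / 2 by linarith) hd]

/-- Divergence inside a convex piece, when the first geodesic has covered the larger
proportion `u` of its part of that piece. -/
lemma dist_le_of_convex {Γ : Z → Z → ℝ → Z} {X : Set Z} {C D E : ℝ}
    (hf : IsConstSpeedGeodesic f L) (hg : IsConstSpeedGeodesic g M) (h₀ : f 0 = g 0)
    (hD : 0 ≤ D) (hE : 1 ≤ E)
    {a₀ a₁ b₀ b₁ c u u' : ℝ} (hX : IsGCCOn E C Γ X)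
    (ha₀ : 0 ≤ a₀) (ha₁ : a₁ ≤ 1) (hb₀ : 0 ≤ b₀) (hb : b₀ ≤ b₁) (hb₁ : b₁ ≤ 1)
    (hfa₀ : f a₀ ∈ X) (hfa₁ : f a₁ ∈ X) (hgb₀ : g b₀ ∈ X) (hgb₁ : g b₁ ∈ X)
    (hp : dist (f a₀) (g b₀) ≤ D)
    (hq : dist (f a₁) (g b₁) ≤ dist (f 1) (g 1) + 4 * D)
    (hfΓ : ∀ t ∈ Set.Icc (0 : ℝ) 1, f (a₀ + t * (a₁ - a₀)) = Γ (f a₀) (f a₁) t)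
    (hgΓ : ∀ t ∈ Set.Icc (0 : ℝ) 1, g (b₀ + t * (b₁ - b₀)) = Γ (g b₀) (g b₁) t)
    (ha_half : 1 / 2 ≤ a₁) (hca₀ : a₀ < c) (hca₁ : c < a₁)
    (hu : a₀ + u * (a₁ - a₀) = c) (hu' : b₀ + u' * (b₁ - b₀) = c)
    (hu'_nonneg : 0 ≤ u') (huu' : u' ≤ u) :
    dist (f c) (g c) ≤ c * (5 * E * dist (f 1) (g 1)) + (19 * E * D + C) := by
  set d := dist (f 1) (g 1)
  have hd : 0 ≤ d := dist_nonneg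
  have hc₀ : 0 < c := ha₀.trans_lt hca₀
  have hu_pos : 0 < u := by
    by_contra! h
    nlinarith
  have hu_le : u ≤ 1 := by
    by_contra! h
    nlinarith
  have hu_le_two : u ≤ 2 * c := by
    have : u * a₁ ≤ c := by nlinarith
    nlinarith
  set τ := u' / u
  have hτ₀ : 0 ≤ τ := by positivity
  have hτ₁ : τ ≤ 1 := (div_le_one hu_pos).2 huu'
  have huτ : u * τ = u' := mul_div_cancel₀ _ hu_pos.ne'
  have hconv := hX.2 _ hfa₀ _ hgb₀ _ hfa₁ _ hgb₁ 1 ⟨zero_le_one, le_rfl⟩ τ ⟨hτ₀, hτ₁⟩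
    u ⟨hu_pos.le, hu_le⟩
  rw [mul_one, huτ, ← hfΓ u ⟨hu_pos.le, hu_le⟩, ← hfΓ 1 ⟨zero_le_one, le_rfl⟩,
    ← hgΓ u' ⟨hu'_nonneg, huu'.trans hu_le⟩, ← hgΓ τ ⟨hτ₀, hτ₁⟩, hu, hu', one_mul,
    add_sub_cancel] at hconv
  have htail : dist (g b₁) (g (b₀ + τ * (b₁ - b₀))) = (1 - τ) * (b₁ - b₀) * M := by
    rw [dist_comm, hg.dist_of_le (by nlinarith) (by nlinarith) hb₁]
    ring
  have htri := dist_triangle (f a₁) (g b₁) (g (b₀ + τ * (b₁ - b₀)))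
  have hlen := (abs_le.1 (hf.abs_length_sub_le hg h₀)).2
  have harc₀ := (abs_le.1 (hf.abs_arclength_sub_le hg h₀ ha₀ (by linarith) hb₀
    (hb.trans hb₁))).1
  have harc₁ := (abs_le.1 (hf.abs_arclength_sub_le hg h₀ (by linarith) ha₁ (hb₀.trans hb)
    hb₁)).1
  have htail_le : u * ((1 - τ) * (b₁ - b₀) * M) ≤ c * d + D + u * (d + 5 * D) := by
    have hsplit : u * ((1 - τ) * (b₁ - b₀) * M)
        = c * (L - M) + (b₀ * M - a₀ * L)
          + u * ((b₁ * M - a₁ * L) + (a₀ * L - b₀ * M)) := by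
      linear_combination (-(b₁ - b₀) * M) * huτ - M * hu' + L * hu
    have harc₀' := (abs_le.1 (hf.abs_arclength_sub_le hg h₀ ha₀ (by linarith) hb₀
      (hb.trans hb₁))).2
    have h₁ := mul_le_mul_of_nonneg_left hlen hc₀.le
    have h₂ := mul_le_mul_of_nonneg_left
      (show (b₁ * M - a₁ * L) + (a₀ * L - b₀ * M) ≤ d + 5 * D by linarith) hu_pos.le
    linarith
  have hmid : u * dist (f a₁) (g (b₀ + τ * (b₁ - b₀))) ≤ 5 * c * d + 18 * D := by
    have h₁ := mul_le_mul_of_nonneg_left (htri.trans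
      (add_le_add hq htail.le)) hu_pos.le
    have h₂ := mul_le_mul_of_nonneg_right hu_le_two hd
    have h₃ := mul_le_mul_of_nonneg_right hu_le hD
    linarith
  have hE₀ : 0 ≤ E := by linarith
  have h₁ := mul_le_mul_of_nonneg_left hmid hE₀
  have h₂ : (1 - u) * E * dist (f a₀) (g b₀) ≤ E * D := by
    have := mul_le_mul_of_nonneg_left hp hE₀
    nlinarith [mul_nonneg hu_pos.le (mul_nonneg hE₀ (dist_nonneg (x := f a₀) (y := g b₀)))]
  linarith

end IsConstSpeedGeodesic

lemma FellowTravel.symm {Z : Type*} [MetricSpace Z] {D : ℝ} {γ δ : ℝ → Z}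
    (h : FellowTravel D γ δ) : FellowTravel D δ γ :=
  ⟨dist_comm (γ 0) _ ▸ h.1, dist_comm (γ 1) _ ▸ h.2.1, Metric.hausdorffDist_comm.trans_le h.2.2⟩

/-- Proposition 4.6: a coarsely `(C,D,E)`-forward thin geodesic bicombing is
`(E*,C*)`-coarsely forward convex, with `E*, C*` depending only on `C, D, E`. -/
theorem coarselyForwardConvex_of_coarselyForwardThin (C D E : ℝ)
    (hC : 0 ≤ C) (hD : 0 ≤ D) (hE : 1 ≤ E) :
    ∃ Estar Cstar : ℝ, 1 ≤ Estar ∧ 0 ≤ Cstar ∧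
      ∀ (Z : Type*) [MetricSpace Z] (Γ : Z → Z → ℝ → Z),
        IsGeodesicBicombing Γ → CoarselyForwardThin C D E Γ →
          CoarselyForwardConvex Estar Cstar Γ := by
  refine ⟨8 * E, 19 * E * D + C + 20 * D + 2, by linarith, by positivity, ?_⟩
  intro Z _ Γ hΓ hthin v w₁ w₂ c ⟨hc₀, hc₁⟩
  have hf : IsConstSpeedGeodesic (Γ v w₁) (dist v w₁) := (hΓ v w₁).2.2
  have hg : IsConstSpeedGeodesic (Γ v w₂) (dist v w₂) := (hΓ v w₂).2.2
  have h₀ : Γ v w₁ 0 = Γ v w₂ 0 := (hΓ v w₁).1.trans (hΓ v w₂).1.symm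
  have hd : dist w₁ w₂ = dist (Γ v w₁ 1) (Γ v w₂ 1) := by
    rw [(hΓ v w₁).2.1, (hΓ v w₂).2.1]
  rw [hd]
  specialize hthin v w₁ w₂
  generalize Γ v w₁ = f at *
  generalize Γ v w₂ = g at *
  generalize dist v w₁ = L at *
  generalize dist v w₂ = M at *
  have hdE : c * dist (f 1) (g 1) ≤ E * (c * dist (f 1) (g 1)) :=
    le_mul_of_one_le_left (by positivity) hE
  have hcd : 0 ≤ c * dist (f 1) (g 1) := by positivity
  have hED : 0 ≤ E * D := by positivity
  have hd₀ : 0 ≤ dist (f 1) (g 1) := dist_nonneg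
  by_cases hmin : 2 * D < min L M
  swap
  · rcases min_le_iff.1 (not_lt.1 hmin) with h | h
    · linarith [hf.dist_le_of_short hg h₀ (K := 2 * D) (by positivity) (by linarith) hc₀ hc₁]
    · have := hg.dist_le_of_short hf h₀.symm (K := 2 * D) (by positivity)
        (by linarith [dist_nonneg (x := g 1) (y := f 1)]) hc₀ hc₁
      rw [dist_comm (g c), dist_comm (g 1)] at this
      linarith
  obtain ⟨X, a₀, a₁, b₀, b₁, hX, ha₀, ha, ha₁, hb₀, hb, hb₁, hfa₀, hfa₁, hgb₀, hgb₁, hft, -,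
    hΓfg, hsum⟩ := hthin hmin
  rw [dist_comm (f 1) (f a₁), hf.dist_of_le (ha₀.trans ha) ha₁ le_rfl,
    hg.dist_of_le (hb₀.trans hb) hb₁ le_rfl] at hsum
  have hfrem : 0 ≤ (1 - a₁) * L := mul_nonneg (by linarith) hf.length_nonneg
  have hgrem : 0 ≤ (1 - b₁) * M := mul_nonneg (by linarith) hg.length_nonneg
  have hab : 0 ≤ dist (f a₁) (g b₁) := dist_nonneg
  rcases lt_or_ge a₁ (1 / 2) with ha_half | ha_half
  · have hL : L ≤ 2 * dist (f 1) (g 1) + 8 * D := by nlinarith [hf.length_nonneg]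
    linarith [hf.dist_le_of_short hg h₀ (by positivity) hL hc₀ hc₁]
  rcases lt_or_ge b₁ (1 / 2) with hb_half | hb_half
  · have hM : M ≤ 2 * dist (g 1) (f 1) + 8 * D := by
      rw [dist_comm (g 1)]
      nlinarith [hg.length_nonneg]
    have := hg.dist_le_of_short hf h₀.symm (by positivity) hM hc₀ hc₁
    rw [dist_comm (g c), dist_comm (g 1)] at this
    linarith
  rcases le_or_gt c a₀ with hca₀ | hca₀
  · linarith [hf.dist_le_of_fellowTravel hg h₀ (ha.trans ha₁) hb₀ (hb.trans hb₁) hft hc₀ hca₀]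
  rcases le_or_gt c b₀ with hcb₀ | hcb₀
  · have := hg.dist_le_of_fellowTravel hf h₀.symm (hb.trans hb₁) ha₀ (ha.trans ha₁) hft.symm
      hc₀ hcb₀
    rw [dist_comm (g c), dist_comm (g 1)] at this
    linarith
  rcases le_or_gt a₁ c with hca₁ | hca₁
  · linarith [hf.dist_le_of_late hg h₀ (K := 4 * D) (by linarith) ha_half hca₁ hc₁]
  rcases le_or_gt b₁ c with hcb₁ | hcb₁
  · have := hg.dist_le_of_late hf h₀.symm (K := 4 * D)
      (by rw [dist_comm (g 1)]; linarith) hb_half hcb₁ hc₁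
    rw [dist_comm (g c), dist_comm (g 1)] at this
    linarith
  have hp : dist (f a₀) (g b₀) ≤ D := by simpa using hft.2.1
  have hq : dist (f a₁) (g b₁) ≤ dist (f 1) (g 1) + 4 * D := by linarith
  have hu : a₀ + (c - a₀) / (a₁ - a₀) * (a₁ - a₀) = c := by
    rw [div_mul_cancel₀ _ (by linarith), add_sub_cancel]
  have hu' : b₀ + (c - b₀) / (b₁ - b₀) * (b₁ - b₀) = c := by
    rw [div_mul_cancel₀ _ (by linarith), add_sub_cancel]
  have hu₀ : 0 ≤ (c - a₀) / (a₁ - a₀) := div_nonneg (by linarith) (by linarith)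
  have hu'₀ : 0 ≤ (c - b₀) / (b₁ - b₀) := div_nonneg (by linarith) (by linarith)
  rcases le_total ((c - b₀) / (b₁ - b₀)) ((c - a₀) / (a₁ - a₀)) with huu | huu
  · linarith [hf.dist_le_of_convex hg h₀ hD hE hX ha₀ ha₁ hb₀ hb hb₁ hfa₀ hfa₁ hgb₀ hgb₁ hp hq
      (fun t ht => (hΓfg t ht).1) (fun t ht => (hΓfg t ht).2) ha_half hca₀ hca₁ hu hu' hu'₀ huu]
  · rw [dist_comm] at hp
    rw [dist_comm (f a₁), dist_comm (f 1)] at hq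
    have := hg.dist_le_of_convex hf h₀.symm hD hE hX hb₀ hb₁ ha₀ ha ha₁ hgb₀ hgb₁ hfa₀ hfa₁ hp hq
      (fun t ht => (hΓfg t ht).2) (fun t ht => (hΓfg t ht).1) hb_half hcb₀ hcb₁ hu' hu hu₀ huu
    rw [dist_comm (g c), dist_comm (g 1)] at this
    linarith
end

section
/- Let Z be a metric space with a geodesic bicombing Γ, and let C ≥ 0, D ≥ 0, E ≥ 1. If Γ is coarsely (C,D,E)-backward thin, then there exist E* ≥ 1 and C* ≥ 0, depending only on C, D, E, such that Γ is (E*,C*)-coarsely backward convex: d(Γ(v1,w)(c), Γ(v2,w)(c)) ≤ (1−c)·E*·d(v1,v2) + C* for all v1, v2, w ∈ Z and c ∈ [0,1]. -/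
open Set in
/-- The distance from a point of a bicombing geodesic to its endpoint. -/
lemma IsGeodesicBicombing.dist_right {Z : Type*} [MetricSpace Z] {Γ : Z → Z → ℝ → Z}
    (hΓ : IsGeodesicBicombing Γ) (v w : Z) {t : ℝ} (ht : t ∈ Icc (0 : ℝ) 1) :
    dist (Γ v w t) w = (1 - t) * dist v w := by
  obtain ⟨-, h1, h⟩ := hΓ v w
  have := h t ht 1 (by simp)
  rwa [h1, abs_sub_comm, abs_of_nonneg (sub_nonneg.2 ht.2)] at this

open Set in
/-- Two geodesics with a common endpoint are close at equal parameters as soon as the point on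
the first one is close to any point of the second one. -/
lemma IsGeodesicBicombing.dist_le_two_mul_dist {Z : Type*} [MetricSpace Z]
    {Γ : Z → Z → ℝ → Z} (hΓ : IsGeodesicBicombing Γ) (v₁ v₂ w : Z) {c t : ℝ}
    (hc : c ∈ Icc (0 : ℝ) 1) (ht : t ∈ Icc (0 : ℝ) 1) :
    dist (Γ v₁ w c) (Γ v₂ w c) ≤
      2 * dist (Γ v₁ w c) (Γ v₂ w t) + (1 - c) * dist v₁ v₂ := by
  have h₁ := hΓ.dist_right v₁ w hc
  have h₂ := hΓ.dist_right v₂ w ht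
  have hq := abs_dist_sub_le (Γ v₁ w c) (Γ v₂ w t) w
  have hv := mul_le_mul_of_nonneg_left (abs_dist_sub_le v₁ v₂ w) (sub_nonneg.2 hc.2)
  rw [← abs_of_nonneg (sub_nonneg.2 hc.2), ← abs_mul, abs_of_nonneg (sub_nonneg.2 hc.2)] at hv
  have hd : dist (Γ v₂ w t) (Γ v₂ w c) ≤
      dist (Γ v₁ w c) (Γ v₂ w t) + (1 - c) * dist v₁ v₂ := by
    rw [(hΓ v₂ w).2.2 t ht c hc, ← abs_of_nonneg (dist_nonneg (x := v₂) (y := w)), ← abs_mul]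
    rw [h₁, h₂] at hq
    rw [abs_le] at hq hv ⊢
    constructor <;> linarith
  linarith [dist_triangle (Γ v₁ w c) (Γ v₂ w t) (Γ v₂ w c)]

open Set in
/-- The crude bound on the distance at equal parameters, going through the endpoint. -/
lemma IsGeodesicBicombing.dist_le_of_common_endpoint {Z : Type*} [MetricSpace Z]
    {Γ : Z → Z → ℝ → Z} (hΓ : IsGeodesicBicombing Γ) (v₁ v₂ w : Z) {c : ℝ}
    (hc : c ∈ Icc (0 : ℝ) 1) :
    dist (Γ v₁ w c) (Γ v₂ w c) ≤
      (1 - c) * (dist v₁ v₂ + 2 * min (dist v₁ w) (dist v₂ w)) := by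
  have h := dist_triangle_right (Γ v₁ w c) (Γ v₂ w c) w
  rw [hΓ.dist_right v₁ w hc, hΓ.dist_right v₂ w hc, ← mul_add] at h
  refine h.trans (mul_le_mul_of_nonneg_left ?_ (sub_nonneg.2 hc.2))
  have := dist_triangle v₁ v₂ w
  have := dist_triangle_left v₂ w v₁
  rcases min_cases (dist v₁ w) (dist v₂ w) with h | h <;> linarith

open Set in
/-- Any point of the first of two fellow travelling segments of bicombing geodesics is close to
some point of the second one. -/
lemma IsGeodesicBicombing.exists_dist_lt_of_fellowTravel {Z : Type*} [MetricSpace Z]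
    {Γ : Z → Z → ℝ → Z} (hΓ : IsGeodesicBicombing Γ) {v₁ v₂ w : Z} {D c c₁ c₁' : ℝ}
    (hc₁ : 0 ≤ c₁) (hc : c ∈ Icc c₁ 1) (hc₁' : c₁' ∈ Icc (0 : ℝ) 1)
    (hft : FellowTravel D (fun t => Γ v₁ w (c₁ + t * (1 - c₁)))
      (fun t => Γ v₂ w (c₁' + t * (1 - c₁')))) :
    ∃ t ∈ Icc (0 : ℝ) 1, dist (Γ v₁ w c) (Γ v₂ w t) < D + 1 := by
  have hmem : ∀ s ∈ Icc (0 : ℝ) 1, ∀ t ∈ Icc (0 : ℝ) 1, s + t * (1 - s) ∈ Icc (0 : ℝ) 1 := by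
    rintro s ⟨hs0, hs1⟩ t ⟨ht0, ht1⟩
    constructor <;> nlinarith
  have hbdd : ∀ v : Z, ∀ s ∈ Icc (0 : ℝ) 1,
      Bornology.IsBounded ((fun t => Γ v w (s + t * (1 - s))) '' Icc (0 : ℝ) 1) := by
    intro v s hs
    refine (Metric.isBounded_closedBall (x := w) (r := dist v w)).subset ?_
    rintro _ ⟨t, ht, rfl⟩
    have hst := hmem s hs t ht
    rw [Metric.mem_closedBall, hΓ.dist_right v w hst]
    exact mul_le_of_le_one_left dist_nonneg (by linarith [hst.1])
  have hne : ∀ f : ℝ → Z, (f '' Icc (0 : ℝ) 1).Nonempty := fun f => ⟨f 0, 0, by simp, rfl⟩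
  have hmem_c : Γ v₁ w c ∈ (fun t => Γ v₁ w (c₁ + t * (1 - c₁))) '' Icc (0 : ℝ) 1 := by
    rcases hc.1.eq_or_lt with rfl | hlt
    · exact ⟨0, by simp, by simp⟩
    · have hpos : 0 < 1 - c₁ := by linarith [hc.2]
      refine ⟨(c - c₁) / (1 - c₁), ⟨div_nonneg (by linarith) hpos.le,
        (div_le_one hpos).2 (by linarith [hc.2])⟩, ?_⟩
      simp only [div_mul_cancel₀ _ hpos.ne', add_sub_cancel]
  obtain ⟨_, ⟨t, ht, rfl⟩, hlt⟩ := Metric.exists_dist_lt_of_hausdorffDist_lt hmem_c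
    (hft.2.2.trans_lt (lt_add_one D))
    (Metric.hausdorffEDist_ne_top_of_nonempty_of_bounded (hne _) (hne _)
      (hbdd v₁ c₁ ⟨hc₁, hc.1.trans hc.2⟩) (hbdd v₂ c₁' hc₁'))
  exact ⟨_, hmem c₁' hc₁' t ht, hlt⟩

open Set in
/-- A coarsely backward thin bicombing is coarsely backward convex, with explicit constants. -/
lemma IsGeodesicBicombing.coarselyBackwardConvex {Z : Type*} [MetricSpace Z] {C D E : ℝ}
    {Γ : Z → Z → ℝ → Z} (hΓ : IsGeodesicBicombing Γ) (hC : 0 ≤ C) (hD : 0 ≤ D) (hE : 1 ≤ E)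
    (h : CoarselyBackwardThin C D E Γ) :
    CoarselyBackwardConvex (4 * E + 1) (2 * (9 * E * D + C + D + 1)) Γ := by
  intro v₁ v₂ w c hc
  have hc' : 0 ≤ 1 - c := sub_nonneg.2 hc.2
  have hd : 0 ≤ (1 - c) * dist v₁ v₂ := mul_nonneg hc' dist_nonneg
  have hEd := mul_le_mul_of_nonneg_right hE hd
  have hED := mul_le_mul_of_nonneg_right hE hD
  have hcD : (1 - c) * D ≤ D := mul_le_of_le_one_left hD (by linarith [hc.1])
  have hcrude := hΓ.dist_le_of_common_endpoint v₁ v₂ w hc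
  by_cases hmin : 2 * D < min (dist v₁ w) (dist v₂ w)
  swap
  · have := mul_le_mul_of_nonneg_left (not_lt.1 hmin) hc'
    linarith
  obtain ⟨X, c₀, c₁, c₀', c₁', ⟨-, hX⟩, hc₀, hc₀₁, hc₁, hc₀', hc₀₁', hc₁', hp₁, ha, hp₂, hb, hft,
    -, hrep, hsum⟩ := h v₁ v₂ w hmin
  have hab := hft.1
  simp only [zero_mul, add_zero] at hab
  have hv₁ := (hΓ v₁ w).1
  have hdist₁ := (hΓ v₁ w).2.2 0 (by simp) c₀ ⟨hc₀, hc₀₁.trans hc₁⟩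
  rw [zero_sub, abs_neg, abs_of_nonneg hc₀] at hdist₁
  rw [hdist₁, hv₁, (hΓ v₂ w).1] at hsum
  have hp₂v₂ := dist_nonneg (x := Γ v₂ w c₀') (y := v₂)
  have hp := dist_nonneg (x := Γ v₁ w c₀) (y := Γ v₂ w c₀')
  have hL₁ := dist_nonneg (x := v₁) (y := w)
  rcases le_total (1 / 2) c₀ with hhalf | hhalf
  · have hL : min (dist v₁ w) (dist v₂ w) ≤ 2 * dist v₁ v₂ + 8 * D :=
      (min_le_left _ _).trans (by nlinarith)
    have := mul_le_mul_of_nonneg_left hL hc'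
    linarith
  suffices hnear : ∃ t ∈ Icc (0 : ℝ) 1, dist (Γ v₁ w c) (Γ v₂ w t) ≤
      2 * E * ((1 - c) * dist v₁ v₂) + (9 * E * D + C + D + 1) by
    obtain ⟨t, ht, hle⟩ := hnear
    linarith [hΓ.dist_le_two_mul_dist v₁ v₂ w hc ht]
  rcases le_or_gt c₁ c with hc₁c | hcc₁
  · obtain ⟨t, ht, hlt⟩ := hΓ.exists_dist_lt_of_fellowTravel (hc₀.trans hc₀₁) ⟨hc₁c, hc.2⟩
      ⟨hc₀'.trans hc₀₁', hc₁'⟩ hft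
    exact ⟨t, ht, by linarith⟩
  rcases le_or_gt c₀ c with hc₀c | hcc₀
  · have hpos : 0 < c₁ - c₀ := by linarith
    set u := (c - c₀) / (c₁ - c₀) with hu
    have hu0 : 0 ≤ u := div_nonneg (by linarith) hpos.le
    have hu1 : u ≤ 1 := (div_le_one hpos).2 (by linarith)
    have huc : u * (c₁ - c₀) = c - c₀ := div_mul_cancel₀ _ hpos.ne'
    have hu2 : 1 - u ≤ 2 * (1 - c) := by nlinarith
    have hmem : c₀' + u * (c₁' - c₀') ∈ Icc (0 : ℝ) 1 := by
      constructor <;> nlinarith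
    refine ⟨_, hmem, ?_⟩
    obtain ⟨hr₁, hr₂⟩ := hrep u ⟨hu0, hu1⟩
    rw [huc, add_sub_cancel] at hr₁
    have hconv := hX _ hp₁ _ hp₂ _ ha _ hb 1 (by simp) 1 (by simp) u ⟨hu0, hu1⟩
    rw [mul_one, ← hr₁, ← hr₂, (hΓ _ _).2.1, (hΓ _ _).2.1] at hconv
    have hP : dist (Γ v₁ w c₀) (Γ v₂ w c₀') ≤ dist v₁ v₂ + 4 * D := by
      linarith [mul_nonneg hc₀ hL₁]
    have hE0 : 0 ≤ E := by linarith
    have h₁ : (1 - u) * E * dist (Γ v₁ w c₀) (Γ v₂ w c₀') ≤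
        2 * (1 - c) * E * (dist v₁ v₂ + 4 * D) := by gcongr
    have h₂ : u * E * dist (Γ v₁ w c₁) (Γ v₂ w c₁') ≤ 1 * E * D := by gcongr
    have h₃ := mul_le_mul_of_nonneg_left hcD hE0
    linarith
  · refine ⟨c₀', ⟨hc₀', hc₀₁'.trans hc₁'⟩, ?_⟩
    have hcp := (hΓ v₁ w).2.2 c hc c₀ ⟨hc₀, hc₀₁.trans hc₁⟩
    rw [abs_sub_comm, abs_of_nonneg (by linarith)] at hcp
    have htri := dist_triangle (Γ v₁ w c) (Γ v₁ w c₀) (Γ v₂ w c₀')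
    have hcL := mul_nonneg hc.1 hL₁
    have hdd : dist v₁ v₂ ≤ 2 * ((1 - c) * dist v₁ v₂) := by
      nlinarith [dist_nonneg (x := v₁) (y := v₂)]
    linarith

/-- Proposition 4.7: a coarsely `(C,D,E)`-backward thin geodesic bicombing is
`(E*,C*)`-coarsely backward convex, with `E*, C*` depending only on `C, D, E`. -/
theorem coarselyBackwardConvex_of_coarselyBackwardThin (C D E : ℝ)
    (hC : 0 ≤ C) (hD : 0 ≤ D) (hE : 1 ≤ E) :
    ∃ Estar Cstar : ℝ, 1 ≤ Estar ∧ 0 ≤ Cstar ∧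
      ∀ (Z : Type*) [MetricSpace Z] (Γ : Z → Z → ℝ → Z),
        IsGeodesicBicombing Γ → CoarselyBackwardThin C D E Γ →
          CoarselyBackwardConvex Estar Cstar Γ := by
  exact ⟨4 * E + 1, 2 * (9 * E * D + C + D + 1), by linarith, by positivity,
    fun _ _ _ hΓ h => hΓ.coarselyBackwardConvex hC hD hE h⟩
end

section
/- Let K be a subgroup of a group G and let S be a topological space with an action of K by homeomorphisms. Let G ×_K S denote the quotient of the set G × S by the equivalence relation generated by (gk, s) ∼ (g, k·s) for g ∈ G, k ∈ K, s ∈ S, equipped with the G-action induced by left multiplication on the first factor, and let ι : S → G ×_K S be the map s ↦ [(1, s)]. Then G ×_K S admits a unique topology such that ι is a topological embedding, ι(S) is open in G ×_K S, and the G-action on G ×_K S is by homeomorphisms. -/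
/-- The relation on `G × S` generated by `(g * k, s) ∼ (g, k • s)` for `k ∈ K`. -/
def inducedRel {G : Type*} [Group G] (K : Subgroup G) (S : Type*) [MulAction K S]
    (p q : G × S) : Prop :=
  ∃ k : K, p.1 = q.1 * k ∧ q.2 = k • p.2

/-- The set `G ×_K S`: the quotient of `G × S` by the equivalence relation generated by
`(g * k, s) ∼ (g, k • s)`. -/
def InducedSpace {G : Type*} [Group G] (K : Subgroup G) (S : Type*) [MulAction K S] :
    Type _ :=
  Quot (inducedRel K S)

/-- The canonical map `ι : S → G ×_K S`, `s ↦ [(1, s)]`. -/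
def inducedIota {G : Type*} [Group G] (K : Subgroup G) (S : Type*) [MulAction K S]
    (s : S) : InducedSpace K S :=
  Quot.mk _ (1, s)

/-- The `G`-action on `G ×_K S` induced by left multiplication on the first factor:
`h • [(g, s)] = [(h * g, s)]`. -/
def inducedSMul {G : Type*} [Group G] (K : Subgroup G) (S : Type*) [MulAction K S]
    (h : G) : InducedSpace K S → InducedSpace K S :=
  Quot.map (fun p => (h * p.1, p.2))
    (fun p q hpq => by
      obtain ⟨k, h1, h2⟩ := hpq
      exact ⟨k, by simp only [h1, mul_assoc], h2⟩)

section InducedSpace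

variable {G : Type*} [Group G] {K : Subgroup G} {S : Type*} [MulAction K S]

theorem inducedRel_equivalence : Equivalence (inducedRel K S) where
  refl p := ⟨1, by simp, by simp⟩
  symm := by
    rintro p q ⟨k, h1, h2⟩
    exact ⟨k⁻¹, by simp [h1], by simp [h2]⟩
  trans := by
    rintro p q r ⟨k, h1, h2⟩ ⟨l, h3, h4⟩
    exact ⟨l * k, by simp [h1, h3, mul_assoc], by simp [h2, h4, mul_smul]⟩

theorem inducedSpace_mk_eq_iff {p q : G × S} :
    (Quot.mk _ p : InducedSpace K S) = Quot.mk _ q ↔ inducedRel K S p q :=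
  ⟨fun h => inducedRel_equivalence.eqvGen_iff.1 (Quot.eqvGen_exact h), fun h => Quot.sound h⟩

theorem inducedIota_injective : Function.Injective (inducedIota K S) := by
  intro s t h
  obtain ⟨k, h1, h2⟩ := inducedSpace_mk_eq_iff.1 h
  have hk : k = 1 := Subtype.ext (by simpa using h1.symm)
  simpa [hk] using h2.symm

theorem inducedSMul_one (x : InducedSpace K S) : inducedSMul K S 1 x = x := by
  induction x using Quot.ind with
  | mk p => exact congrArg (Quot.mk _) (Prod.ext (one_mul p.1) rfl)

theorem inducedSMul_inducedSMul (g h : G) (x : InducedSpace K S) :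
    inducedSMul K S g (inducedSMul K S h x) = inducedSMul K S (g * h) x := by
  induction x using Quot.ind with
  | mk p => exact congrArg (Quot.mk _) (Prod.ext (mul_assoc g h p.1).symm rfl)

theorem inducedSMul_inducedIota_eq_iff {g : G} {s t : S} :
    inducedSMul K S g (inducedIota K S s) = inducedIota K S t ↔
      ∃ k : K, g = k ∧ t = k • s := by
  refine (inducedSpace_mk_eq_iff (p := (g * 1, s)) (q := (1, t))).trans ?_
  simp [inducedRel]

theorem exists_inducedSMul_inducedIota_eq (x : InducedSpace K S) :
    ∃ (g : G) (s : S), inducedSMul K S g (inducedIota K S s) = x := by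
  induction x using Quot.ind with
  | mk p => exact ⟨p.1, p.2, congrArg (Quot.mk _) (Prod.ext (mul_one p.1) rfl)⟩

variable [TopologicalSpace S]

variable (K S) in
/-- The topology on `G ×_K S` that is final with respect to the translates of `ι`. -/
abbrev inducedTopology : TopologicalSpace (InducedSpace K S) :=
  ⨆ g : G, TopologicalSpace.coinduced
    (fun s => inducedSMul K S g (inducedIota K S s)) inferInstance

theorem isOpen_inducedTopology_iff {U : Set (InducedSpace K S)} :
    @IsOpen _ (inducedTopology K S) U ↔
      ∀ g : G, IsOpen ((fun s => inducedSMul K S g (inducedIota K S s)) ⁻¹' U) := by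
  simp only [isOpen_iSup_iff, isOpen_coinduced]

theorem isHomeomorph_inducedSMul (h : G) :
    @IsHomeomorph _ _ (inducedTopology K S) (inducedTopology K S) (inducedSMul K S h) := by
  let _ := inducedTopology K S
  have hc (h : G) : Continuous (inducedSMul K S h) := by
    refine ⟨fun U hU => isOpen_inducedTopology_iff.2 fun g => ?_⟩
    have := isOpen_inducedTopology_iff.1 hU (h * g)
    simpa only [Set.preimage_preimage, inducedSMul_inducedSMul] using this
  refine isHomeomorph_iff_exists_inverse.2 ⟨hc h, inducedSMul K S h⁻¹, ?_, ?_, hc h⁻¹⟩ <;>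
    intro x <;> simp [inducedSMul_inducedSMul, inducedSMul_one]

theorem isOpenEmbedding_inducedIota (hK : ∀ k : K, Continuous (fun s : S => k • s)) :
    @Topology.IsOpenEmbedding _ _ _ (inducedTopology K S) (inducedIota K S) := by
  let _ := inducedTopology K S
  refine .of_continuous_injective_isOpenMap ⟨fun U hU => ?_⟩ inducedIota_injective
    fun V hV => isOpen_inducedTopology_iff.2 fun g => ?_
  · simpa only [inducedSMul_one] using isOpen_inducedTopology_iff.1 hU 1
  · by_cases hg : g ∈ K
    · convert hV.preimage (hK ⟨g, hg⟩) using 1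
      ext s
      simp only [Set.mem_preimage, Set.mem_image]
      constructor
      · rintro ⟨t, ht, h⟩
        obtain ⟨k, rfl, rfl⟩ := inducedSMul_inducedIota_eq_iff.1 h.symm
        exact ht
      · exact fun hs => ⟨_, hs, (inducedSMul_inducedIota_eq_iff.2 ⟨⟨g, hg⟩, rfl, rfl⟩).symm⟩
    · convert isOpen_empty
      refine Set.eq_empty_of_forall_notMem ?_
      rintro s ⟨t, -, h⟩
      obtain ⟨k, rfl, -⟩ := inducedSMul_inducedIota_eq_iff.1 h.symm
      exact hg k.2

theorem eq_inducedTopology [τ : TopologicalSpace (InducedSpace K S)]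
    (hι : Topology.IsOpenEmbedding (inducedIota K S))
    (hG : ∀ h : G, IsHomeomorph (inducedSMul K S h)) : τ = inducedTopology K S := by
  refine TopologicalSpace.ext_iff.2 fun U => ⟨fun hU => isOpen_inducedTopology_iff.2 fun g =>
    hU.preimage ((hG g).continuous.comp hι.continuous), fun hU => ?_⟩
  refine isOpen_iff_forall_mem_open.2 fun x hx => ?_
  obtain ⟨g, s, rfl⟩ := exists_inducedSMul_inducedIota_eq x
  exact ⟨_, Set.image_preimage_subset _ U,
    ((hG g).isOpenMap.comp hι.isOpenMap) _ (isOpen_inducedTopology_iff.1 hU g),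
    Set.mem_image_of_mem _ hx⟩

end InducedSpace

/-- Proposition 4.3 (of Section "Construction of equivariant trees of spaces"):
if `K ≤ G` and `S` is a `K`-space, then `G ×_K S` admits a unique topology such that the
canonical map `ι : S → G ×_K S` is a topological embedding with open image, and the induced
`G`-action on `G ×_K S` is by homeomorphisms. -/
theorem inducedSpace_unique_topology {G : Type*} [Group G] (K : Subgroup G)
    (S : Type*) [TopologicalSpace S] [MulAction K S]
    (hK : ∀ k : K, IsHomeomorph (fun s : S => k • s)) :
    ∃! τ : TopologicalSpace (InducedSpace K S),
      @Topology.IsEmbedding S (InducedSpace K S) _ τ (inducedIota K S) ∧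
      @IsOpen (InducedSpace K S) τ (Set.range (inducedIota K S)) ∧
      ∀ h : G, @IsHomeomorph (InducedSpace K S) (InducedSpace K S) τ τ
        (inducedSMul K S h) := by
  let _ := inducedTopology K S
  have hι := isOpenEmbedding_inducedIota fun k => (hK k).continuous
  refine ⟨_, ⟨hι.isEmbedding, hι.isOpen_range, isHomeomorph_inducedSMul⟩, ?_⟩
  rintro τ ⟨hemb, hopen, hG⟩
  exact eq_inducedTopology ⟨hemb, hopen⟩ hG
end

section
/- Let Z be a metric space and let γ1, γ2 : [0,1] → Z be geodesics (i.e. d(γi(t), γi(s)) = |t−s|·d(γi(0), γi(1)) for all t, s ∈ [0,1]) with γ1(0) = γ2(0). Let c1 ≤ c1' in [0,1], and set a = γ1(c1), b = γ2(c1'). If d(γ1(1), γ2(1)) = d(γ1(1), a) + d(a, b) + d(b, γ2(1)), then d(a, b) ≤ c1' · d(γ1(1), γ2(1)). -/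
/-- A geodesic parametrized on `[0,1]`: `d(γ(t), γ(s)) = |t−s| · d(γ(0), γ(1))`. -/
def IsGeodesicPath {Z : Type*} [MetricSpace Z] (γ : ℝ → Z) : Prop :=
  ∀ t ∈ Set.Icc (0 : ℝ) 1, ∀ s ∈ Set.Icc (0 : ℝ) 1,
    dist (γ t) (γ s) = |t - s| * dist (γ 0) (γ 1)

/-- If `γ₁, γ₂` are geodesics with the same initial point, `c₁ ≤ c₁'` in `[0,1]`,
`a = γ₁(c₁)`, `b = γ₂(c₁')`, and the distance `d(γ₁(1), γ₂(1))` decomposes as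
`d(γ₁(1),a) + d(a,b) + d(b,γ₂(1))`, then `d(a,b) ≤ c₁' · d(γ₁(1), γ₂(1))`. -/
theorem dist_le_of_geodesic_decomposition {Z : Type*} [MetricSpace Z]
    (γ₁ γ₂ : ℝ → Z) (h₁ : IsGeodesicPath γ₁) (h₂ : IsGeodesicPath γ₂)
    (h0 : γ₁ 0 = γ₂ 0) (c₁ c₁' : ℝ) (hc₁ : c₁ ∈ Set.Icc (0 : ℝ) 1)
    (hc₁' : c₁' ∈ Set.Icc (0 : ℝ) 1) (hle : c₁ ≤ c₁')
    (hsum : dist (γ₁ 1) (γ₂ 1) =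
      dist (γ₁ 1) (γ₁ c₁) + dist (γ₁ c₁) (γ₂ c₁') + dist (γ₂ c₁') (γ₂ 1)) :
    dist (γ₁ c₁) (γ₂ c₁') ≤ c₁' * dist (γ₁ 1) (γ₂ 1) := by
  obtain ⟨hc0, hc1⟩ := hc₁
  obtain ⟨hc0', hc1'⟩ := hc₁'
  have zero_mem : (0 : ℝ) ∈ Set.Icc (0 : ℝ) 1 := ⟨le_rfl, zero_le_one⟩
  have one_mem : (1 : ℝ) ∈ Set.Icc (0 : ℝ) 1 := ⟨zero_le_one, le_rfl⟩
  have ha : dist (γ₁ c₁) (γ₁ 0) = c₁ * dist (γ₁ 0) (γ₁ 1) := by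
    rw [h₁ c₁ ⟨hc0, hc1⟩ 0 zero_mem, sub_zero, abs_of_nonneg hc0]
  have hb : dist (γ₂ 0) (γ₂ c₁') = c₁' * dist (γ₂ 0) (γ₂ 1) := by
    rw [dist_comm, h₂ c₁' ⟨hc0', hc1'⟩ 0 zero_mem, sub_zero, abs_of_nonneg hc0']
  have ha' : dist (γ₁ 1) (γ₁ c₁) = (1 - c₁) * dist (γ₁ 0) (γ₁ 1) := by
    rw [h₁ 1 one_mem c₁ ⟨hc0, hc1⟩, abs_of_nonneg (sub_nonneg.2 hc1)]
  have hb' : dist (γ₂ c₁') (γ₂ 1) = (1 - c₁') * dist (γ₂ 0) (γ₂ 1) := by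
    rw [dist_comm, h₂ 1 one_mem c₁' ⟨hc0', hc1'⟩, abs_of_nonneg (sub_nonneg.2 hc1')]
  have htri : dist (γ₁ c₁) (γ₂ c₁') ≤
      c₁ * dist (γ₁ 0) (γ₁ 1) + c₁' * dist (γ₂ 0) (γ₂ 1) := by
    rw [← ha, ← hb, h0]
    exact dist_triangle _ _ _
  have hscaled := mul_le_mul_of_nonneg_left htri (sub_nonneg.2 hc1')
  have hgap := mul_nonneg (sub_nonneg.2 hle) (dist_nonneg (x := γ₁ 0) (y := γ₁ 1))
  rw [hsum, ha', hb']
  linarith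
end

section
/- Let Z be a metric space, λ ≥ 1, c ≥ 0, m ≥ 1, and let v_0, …, v_{m+1} ∈ Z with d(v_i, v_{i+1}) > 0 for each i. Set t_0 = 0, t_{i+1} = t_i + d(v_i, v_{i+1}), and T = t_{m+1}. For each i = 0, …, m let σ_i : [0,1] → Z be a (λ,c)-quasi-geodesic from v_i to v_{i+1}, i.e. σ_i(0) = v_i, σ_i(1) = v_{i+1}, and λ⁻¹|u−u'|·d(v_i,v_{i+1}) − c ≤ d(σ_i(u), σ_i(u')) ≤ λ|u−u'|·d(v_i,v_{i+1}) + c for all u, u' ∈ [0,1]. Let f : [0,1] → Z be the concatenation: f(t) = σ_i((tT − t_i)/(t_{i+1} − t_i)) for t ∈ [t_i/T, t_{i+1}/T]. Assume distances are additive along the chain: for all i < j and u, u' ∈ [0,1], d(σ_i(u), σ_j(u')) = d(σ_i(u), v_{i+1}) + Σ_{l=i+1}^{j−1} d(v_l, v_{l+1}) + d(v_j, σ_j(u')). Then d(v_0, v_{m+1}) = T, and f is a (λ, 2c)-quasi-geodesic: for all t, s ∈ [0,1], λ⁻¹|s−t|·d(v_0, v_{m+1}) − 2c ≤ d(f(t),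 f(s)) ≤ λ|s−t|·d(v_0, v_{m+1}) + 2c. -/
/-- If `t` increases by `d i` at step `i` up to index `n`, partial sums of `d` are increments of `t`. -/
theorem sum_Ico_eq_sub_of_step {t d : ℕ → ℝ} {n : ℕ} (h : ∀ i ≤ n, t (i + 1) = t i + d i)
    {a b : ℕ} (hab : a ≤ b) (hb : b ≤ n + 1) :
    ∑ l ∈ Finset.Ico a b, d l = t b - t a := by
  rw [← Finset.sum_Ico_sub t hab]
  refine Finset.sum_congr rfl fun l hl => ?_
  rw [h l (by have := (Finset.mem_Ico.mp hl).2; omega)]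
  ring

/-- The consecutive intervals `[t i, t (i + 1)]`, `i ≤ k`, cover `[t 0, t (k + 1)]`. -/
theorem exists_mem_Icc_consecutive (t : ℕ → ℝ) (k : ℕ) {x : ℝ}
    (hx : x ∈ Set.Icc (t 0) (t (k + 1))) : ∃ i ≤ k, x ∈ Set.Icc (t i) (t (i + 1)) := by
  induction k with
  | zero => exact ⟨0, le_rfl, hx⟩
  | succ k ih =>
    rcases le_total x (t (k + 1)) with h | h
    · obtain ⟨i, hi, hxi⟩ := ih ⟨hx.1, h⟩
      exact ⟨i, by omega, hxi⟩
    · exact ⟨k + 1, le_rfl, h, hx.2⟩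


/-- Concatenation of `(λ,c)`-quasi-geodesics along a chain of points where distances are
additive is a `(λ,2c)`-quasi-geodesic (Theorem 6.1(2) of the paper, for trees of spaces). -/
theorem concat_quasi_geodesic {Z : Type*} [MetricSpace Z]
    (lam c : ℝ) (hlam : 1 ≤ lam) (hc : 0 ≤ c)
    (m : ℕ) (hm : 1 ≤ m) (v : ℕ → Z)
    (hpos : ∀ i ≤ m, 0 < dist (v i) (v (i + 1)))
    (t : ℕ → ℝ) (ht0 : t 0 = 0)
    (hts : ∀ i ≤ m, t (i + 1) = t i + dist (v i) (v (i + 1)))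
    (σ : ℕ → ℝ → Z)
    (hσ : ∀ i ≤ m, σ i 0 = v i ∧ σ i 1 = v (i + 1) ∧
      ∀ u ∈ Set.Icc (0 : ℝ) 1, ∀ u' ∈ Set.Icc (0 : ℝ) 1,
        lam⁻¹ * |u - u'| * dist (v i) (v (i + 1)) - c ≤ dist (σ i u) (σ i u') ∧
        dist (σ i u) (σ i u') ≤ lam * |u - u'| * dist (v i) (v (i + 1)) + c)
    (f : ℝ → Z)
    (hf : ∀ i ≤ m, ∀ s ∈ Set.Icc (t i / t (m + 1)) (t (i + 1) / t (m + 1)),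
      f s = σ i ((s * t (m + 1) - t i) / (t (i + 1) - t i)))
    (hadd : ∀ i j : ℕ, i < j → j ≤ m →
      ∀ u ∈ Set.Icc (0 : ℝ) 1, ∀ u' ∈ Set.Icc (0 : ℝ) 1,
        dist (σ i u) (σ j u') =
          dist (σ i u) (v (i + 1)) +
            (∑ l ∈ Finset.Ico (i + 1) j, dist (v l) (v (l + 1))) +
            dist (v j) (σ j u')) :
    dist (v 0) (v (m + 1)) = t (m + 1) ∧
    ∀ s ∈ Set.Icc (0 : ℝ) 1, ∀ s' ∈ Set.Icc (0 : ℝ) 1,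
      lam⁻¹ * |s' - s| * dist (v 0) (v (m + 1)) - 2 * c ≤ dist (f s) (f s') ∧
      dist (f s) (f s') ≤ lam * |s' - s| * dist (v 0) (v (m + 1)) + 2 * c := by
  have hlam0 : 0 < lam := by linarith
  have hsum {a b : ℕ} (hab : a ≤ b) (hb : b ≤ m + 1) :
      ∑ l ∈ Finset.Ico a b, dist (v l) (v (l + 1)) = t b - t a :=
    sum_Ico_eq_sub_of_step hts hab hb
  have hmono {a b : ℕ} (hab : a ≤ b) (hb : b ≤ m + 1) : t a ≤ t b := by
    have := hsum hab hb
    have h0 : 0 ≤ ∑ l ∈ Finset.Ico a b, dist (v l) (v (l + 1)) :=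
      Finset.sum_nonneg fun _ _ => dist_nonneg
    linarith
  have hT : 0 < t (m + 1) := by
    have := hmono (Nat.zero_le m) (Nat.le_succ m)
    rw [hts m le_rfl]
    linarith [hpos m le_rfl]
  have hends : dist (v 0) (v (m + 1)) = t (m + 1) := by
    have h := hadd 0 m (by omega) le_rfl 0 (by simp) 1 (by simp)
    rw [(hσ 0 (by omega)).1, (hσ m le_rfl).2.1, hsum (by omega) (by omega)] at h
    have h0 := hts 0 (by omega)
    have h1 := hts m le_rfl
    linarith
  refine ⟨hends, ?_⟩
  rw [hends]
  let g : ℕ → ℝ → Z := fun i x => σ i ((x - t i) / (t (i + 1) - t i))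
  have hstep {i : ℕ} (hi : i ≤ m) : 0 < t (i + 1) - t i := by
    have := hts i hi
    linarith [hpos i hi]
  have hparam {i : ℕ} (hi : i ≤ m) {x : ℝ} (hx : x ∈ Set.Icc (t i) (t (i + 1))) :
      (x - t i) / (t (i + 1) - t i) ∈ Set.Icc (0 : ℝ) 1 := by
    have := hstep hi
    refine ⟨div_nonneg (by linarith [hx.1]) this.le, ?_⟩
    rw [div_le_one this]
    linarith [hx.2]
  have hleft {i : ℕ} (hi : i ≤ m) : g i (t i) = v i := by
    simp [g, (hσ i hi).1]
  have hright {i : ℕ} (hi : i ≤ m) : g i (t (i + 1)) = v (i + 1) := by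
    simp [g, div_self (hstep hi).ne', (hσ i hi).2.1]
  have hpiece {i : ℕ} (hi : i ≤ m) {x y : ℝ} (hx : x ∈ Set.Icc (t i) (t (i + 1)))
      (hy : y ∈ Set.Icc (t i) (t (i + 1))) :
      lam⁻¹ * |y - x| - c ≤ dist (g i x) (g i y) ∧
        dist (g i x) (g i y) ≤ lam * |y - x| + c := by
    have h := (hσ i hi).2.2 _ (hparam hi hx) _ (hparam hi hy)
    have hd : dist (v i) (v (i + 1)) = t (i + 1) - t i := by linarith [hts i hi]
    have hscale : |(x - t i) / (t (i + 1) - t i) - (y - t i) / (t (i + 1) - t i)| *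
        (t (i + 1) - t i) = |y - x| := by
      rw [← sub_div, abs_div, abs_of_pos (hstep hi), div_mul_cancel₀ _ (hstep hi).ne',
        sub_sub_sub_cancel_right, abs_sub_comm]
    rwa [hd, mul_assoc, mul_assoc, hscale] at h
  have hordered {i j : ℕ} (hij : i ≤ j) (hj : j ≤ m) {x y : ℝ}
      (hx : x ∈ Set.Icc (t i) (t (i + 1))) (hy : y ∈ Set.Icc (t j) (t (j + 1))) :
      lam⁻¹ * |y - x| - 2 * c ≤ dist (g i x) (g j y) ∧
        dist (g i x) (g j y) ≤ lam * |y - x| + 2 * c := by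
    rcases hij.eq_or_lt with rfl | hlt
    · have := hpiece hj hx hy
      constructor <;> linarith
    · have hi : i ≤ m := by omega
      have hmid := hmono (show i + 1 ≤ j from hlt) (by omega)
      have h := hadd i j hlt hj _ (hparam hi hx) _ (hparam hj hy)
      change dist (g i x) (g j y) = dist (g i x) _ + _ + dist _ (g j y) at h
      rw [hsum hlt (by omega), ← hright hi, ← hleft hj] at h
      have h1 := hpiece hi hx ⟨by linarith [hstep hi], le_rfl⟩
      have h2 := hpiece hj ⟨le_rfl, by linarith [hstep hj]⟩ hy
      rw [abs_of_nonneg (by linarith [hx.2])] at h1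
      rw [abs_of_nonneg (by linarith [hy.1])] at h2
      rw [abs_of_nonneg (by linarith [hx.2, hy.1]), h]
      have hlow : lam⁻¹ * (t j - t (i + 1)) ≤ t j - t (i + 1) :=
        mul_le_of_le_one_left (by linarith) (inv_le_one_of_one_le₀ hlam)
      have hup : t j - t (i + 1) ≤ lam * (t j - t (i + 1)) :=
        le_mul_of_one_le_left (by linarith) hlam
      constructor <;> linarith
  have hlocate {s : ℝ} (hs : s ∈ Set.Icc (0 : ℝ) 1) :
      ∃ i ≤ m, s * t (m + 1) ∈ Set.Icc (t i) (t (i + 1)) ∧ f s = g i (s * t (m + 1)) := by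
    obtain ⟨i, hi, hx⟩ := exists_mem_Icc_consecutive t m (x := s * t (m + 1))
      ⟨by rw [ht0]; exact mul_nonneg hs.1 hT.le, mul_le_of_le_one_left hT.le hs.2⟩
    exact ⟨i, hi, hx, hf i hi s ⟨(div_le_iff₀ hT).2 hx.1, (le_div_iff₀ hT).2 hx.2⟩⟩
  intro s hs s' hs'
  obtain ⟨i, hi, hx, hfs⟩ := hlocate hs
  obtain ⟨j, hj, hy, hfs'⟩ := hlocate hs'
  have hscale : |s' * t (m + 1) - s * t (m + 1)| = |s' - s| * t (m + 1) := by
    rw [← sub_mul, abs_mul, abs_of_pos hT]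
  rw [mul_assoc, mul_assoc, ← hscale, hfs, hfs']
  rcases le_total i j with hij | hij
  · exact hordered hij hj hx hy
  · rw [dist_comm, abs_sub_comm]
    exact hordered hij hi hy hx
end

section
/- For i = 1,2, let G_i be a group, 𝓗_i a finite collection of subgroups of G_i, K_i a subgroup of G_i, and ∂_i : C → G_i an injective group homomorphism with ∂_i(C) ≤ K_i. Let G = G_1 ∗_C G_2 be the amalgamated free product determined by ∂_1, ∂_2, with canonical injections ι_i : G_i → G, and let 𝓗 = {ι_1(H) : H ∈ 𝓗_1} ∪ {ι_2(H) : H ∈ 𝓗_2} ∪ {⟨ι_1(K_1) ∪ ι_2(K_2)⟩}. Then for each i and each g ∈ G_i, the element g is conjugate in G_i to an element of some Q ∈ 𝓗_i ∪ {K_i} if and only if ι_i(g) is conjugate in G to an element of some H ∈ 𝓗. -/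
open Monoid

namespace Monoid.PushoutI

section

variable {ι : Type*} {G : ι → Type*} {C : Type*} [∀ i, Group (G i)] [Group C] (φ : ∀ i, C →* G i)

/-- The product in the pushout of a list of letters from the factors. -/
def listProd (l : List (Σ i, G i)) : PushoutI φ :=
  (l.map fun p => of p.1 p.2).prod

/-- A list of letters is reduced if consecutive letters come from distinct factors and no letter
lies in the image of the base group. -/
structure IsReducedList (l : List (Σ i, G i)) : Prop where
  chain_ne : l.IsChain fun p q => p.1 ≠ q.1
  notMem_range : ∀ p ∈ l, p.2 ∉ (φ p.1).range

/-- Some bound on the word length holds for all powers of `x`. -/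
def HasBoundedPowers (x : PushoutI φ) : Prop :=
  ∃ N : ℕ, ∀ n : ℕ, ∃ l : List (Σ i, G i), l.length ≤ N ∧ listProd φ l = x ^ n

variable {φ}

@[simp]
theorem listProd_nil : listProd φ [] = 1 := rfl

@[simp]
theorem listProd_cons (p : Σ i, G i) (l : List (Σ i, G i)) :
    listProd φ (p :: l) = of p.1 p.2 * listProd φ l := by
  simp [listProd]

@[simp]
theorem listProd_append (l m : List (Σ i, G i)) :
    listProd φ (l ++ m) = listProd φ l * listProd φ m := by
  simp [listProd]

theorem listProd_flatten_replicate (l : List (Σ i, G i)) (n : ℕ) :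
    listProd φ (List.replicate n l).flatten = listProd φ l ^ n := by
  induction n with
  | zero => simp
  | succ n ih => simp [List.replicate_succ, pow_succ', ih]

/-- The list of letters spelling the inverse. -/
def invList (l : List (Σ i, G i)) : List (Σ i, G i) :=
  (l.map fun p => ⟨p.1, p.2⁻¹⟩).reverse

theorem listProd_invList (l : List (Σ i, G i)) :
    listProd φ (invList l) = (listProd φ l)⁻¹ := by
  induction l with
  | nil => simp [invList]
  | cons p l ih =>
    simp only [invList, List.map_cons, List.reverse_cons] at ih ⊢
    simp [ih]

theorem IsReducedList.invList {l : List (Σ i, G i)} (hl : IsReducedList φ l) :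
    IsReducedList φ (invList l) where
  chain_ne := by
    rw [PushoutI.invList, List.isChain_reverse, List.isChain_map]
    exact hl.chain_ne.imp fun _ _ h => h.symm
  notMem_range := by
    simp only [PushoutI.invList, List.mem_reverse, List.mem_map]
    rintro _ ⟨p, hp, rfl⟩
    simpa only [inv_mem_iff] using hl.notMem_range p hp

theorem IsReducedList.nil : IsReducedList φ ([] : List (Σ i, G i)) :=
  ⟨List.isChain_nil, by simp⟩

theorem IsReducedList.append {l m : List (Σ i, G i)} (hl : IsReducedList φ l)
    (hm : IsReducedList φ m) (h : ∀ p ∈ l.getLast?, ∀ q ∈ m.head?, p.1 ≠ q.1) :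
    IsReducedList φ (l ++ m) where
  chain_ne := List.isChain_append.2 ⟨hl.chain_ne, hm.chain_ne, h⟩
  notMem_range p hp :=
    (List.mem_append.1 hp).elim (hl.notMem_range p) (hm.notMem_range p)

theorem IsReducedList.left_of_append {l m : List (Σ i, G i)} (h : IsReducedList φ (l ++ m)) :
    IsReducedList φ l :=
  ⟨(List.isChain_append.1 h.chain_ne).1, fun p hp => h.notMem_range p (by simp [hp])⟩

theorem IsReducedList.tail {p : Σ i, G i} {l : List (Σ i, G i)} (h : IsReducedList φ (p :: l)) :
    IsReducedList φ l :=
  ⟨h.chain_ne.tail, fun q hq => h.notMem_range q (by simp [hq])⟩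

theorem IsReducedList.replace_head {i : ι} {a b : G i} {l : List (Σ i, G i)}
    (h : IsReducedList φ (⟨i, a⟩ :: l)) (hb : b ∉ (φ i).range) :
    IsReducedList φ (⟨i, b⟩ :: l) where
  chain_ne := List.isChain_cons.2 (List.isChain_cons.1 h.chain_ne)
  notMem_range p hp := by
    rcases List.mem_cons.1 hp with rfl | hp
    · exact hb
    · exact h.tail.notMem_range p hp

theorem IsReducedList.flatten_replicate {l : List (Σ i, G i)} (hl : IsReducedList φ l)
    (hne : l ≠ []) (h : ∀ p ∈ l.getLast?, ∀ q ∈ l.head?, p.1 ≠ q.1) (n : ℕ) :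
    IsReducedList φ (List.replicate n l).flatten where
  chain_ne := by
    refine (List.isChain_flatten fun hmem => hne (List.eq_of_mem_replicate hmem).symm).2
      ⟨fun m hm => ?_, List.isChain_replicate_of_rel n h⟩
    rw [List.eq_of_mem_replicate hm]
    exact hl.chain_ne
  notMem_range p hp := by
    obtain ⟨m, hm, hp⟩ := List.mem_flatten.1 hp
    rw [List.eq_of_mem_replicate hm] at hp
    exact hl.notMem_range p hp

/-- All reduced spellings of an element, up to a base factor, have the same length. -/
theorem IsReducedList.length_eq (hφ : ∀ i, Function.Injective (φ i)) {l m : List (Σ i, G i)}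
    (hl : IsReducedList φ l) (hm : IsReducedList φ m) {c d : C}
    (h : base φ c * listProd φ l = base φ d * listProd φ m) : l.length = m.length := by
  classical
  obtain ⟨t⟩ := NormalWord.transversal_nonempty φ hφ
  have key : ∀ (l : List (Σ i, G i)) (c : C), IsReducedList φ l → ∃ w : NormalWord t,
      w.prod = base φ c * listProd φ l ∧ w.toList.length = l.length := by
    intro l c hl
    let v : CoprodI.Word G := ⟨l, fun p hp h1 => hl.notMem_range p hp (h1 ▸ one_mem _), hl.chain_ne⟩
    have hv : Reduced φ v := hl.notMem_range
    obtain ⟨w, hw, hw'⟩ := hv.exists_normalWord_prod_eq t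
    refine ⟨base φ c • w, ?_, ?_⟩
    · rw [NormalWord.prod_smul, hw]
      simp [v, CoprodI.Word.prod, listProd, map_list_prod, Function.comp_def]
    · rw [NormalWord.base_smul_def]
      simpa [v] using congrArg List.length hw'
  obtain ⟨w, hw, hwl⟩ := key l c hl
  obtain ⟨v, hv, hvm⟩ := key m d hm
  rw [← hwl, ← hvm, NormalWord.prod_injective (hw.trans (h.trans hv.symm))]

/-- Multiplying a reduced spelling on the left by a letter lengthens it by at most one. -/
theorem IsReducedList.exists_of_mul {K : ∀ i, Subgroup (G i)} (hK : ∀ i, (φ i).range ≤ K i)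
    {l : List (Σ i, G i)} (hl : IsReducedList φ l) (hlK : ∀ p ∈ l, p.2 ∈ K p.1) (c : C)
    {i : ι} {k : G i} (hk : k ∈ K i) :
    ∃ d m, IsReducedList φ m ∧ (∀ p ∈ m, p.2 ∈ K p.1) ∧ m.length ≤ l.length + 1 ∧
      of i k * (base φ c * listProd φ l) = base φ d * listProd φ m := by
  have hkc : k * φ i c ∈ K i := mul_mem hk (hK i ⟨c, rfl⟩)
  have hmul : of i k * (base φ c * listProd φ l) = of i (k * φ i c) * listProd φ l := by
    rw [map_mul, of_apply_eq_base, mul_assoc]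
  rw [hmul]
  generalize k * φ i c = a at hkc
  by_cases ha : a ∈ (φ i).range
  · obtain ⟨d, rfl⟩ := ha
    exact ⟨d, l, hl, hlK, by lia, by rw [of_apply_eq_base]⟩
  by_cases hhead : ∀ q ∈ l.head?, i ≠ q.1
  · refine ⟨1, ⟨i, a⟩ :: l, ⟨List.isChain_cons.2 ⟨hhead, hl.chain_ne⟩, ?_⟩, ?_, by simp, by simp⟩
    · rintro p (_ | ⟨_, hp⟩)
      exacts [ha, hl.notMem_range p hp]
    · rintro p (_ | ⟨_, hp⟩)
      exacts [hkc, hlK p hp]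
  cases l with
  | nil => simp at hhead
  | cons q l =>
    obtain ⟨j, b⟩ := q
    obtain rfl : i = j := by simpa using hhead
    have hb : b ∈ K i := hlK ⟨i, b⟩ (by simp)
    have hl' : ∀ p ∈ l, p.2 ∈ K p.1 := fun p hp => hlK p (by simp [hp])
    by_cases hab : a * b ∈ (φ i).range
    · obtain ⟨d, hd⟩ := hab
      refine ⟨d, l, hl.tail, hl', by simp; lia, ?_⟩
      rw [← of_apply_eq_base φ i, hd, listProd_cons, map_mul, mul_assoc]
    · refine ⟨1, ⟨i, a * b⟩ :: l, hl.replace_head hab, ?_, by simp, by simp [mul_assoc]⟩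
      rintro p (_ | ⟨_, hp⟩)
      exacts [mul_mem hkc hb, hl' p hp]

theorem exists_isReducedList_listProd (m : List (Σ i, G i)) :
    ∃ (c : C) (l : List (Σ i, G i)), IsReducedList φ l ∧ l.length ≤ m.length ∧
      listProd φ m = base φ c * listProd φ l := by
  induction m with
  | nil => exact ⟨1, [], .nil, le_rfl, by simp⟩
  | cons p m ih =>
    obtain ⟨c, l, hl, hlen, h⟩ := ih
    obtain ⟨d, l', hl', -, hlen', h'⟩ :=
      hl.exists_of_mul (K := fun _ => ⊤) (by simp) (by simp) c (Subgroup.mem_top p.2)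
    exact ⟨d, l', hl', by simp; lia, by rw [listProd_cons, h, h']⟩

theorem exists_isReducedList_of_mem_closure {K : ∀ i, Subgroup (G i)}
    (hK : ∀ i, (φ i).range ≤ K i) {x : PushoutI φ}
    (hx : x ∈ Subgroup.closure (⋃ i, of (φ := φ) i '' (K i : Set (G i)))) :
    ∃ (c : C) (l : List (Σ i, G i)), IsReducedList φ l ∧ (∀ p ∈ l, p.2 ∈ K p.1) ∧
      x = base φ c * listProd φ l := by
  have step : ∀ {i : ι} {k : G i}, k ∈ K i → ∀ {y : PushoutI φ},
      (∃ (c : C) (l : List (Σ i, G i)), IsReducedList φ l ∧ (∀ p ∈ l, p.2 ∈ K p.1) ∧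
        y = base φ c * listProd φ l) →
      ∃ (c : C) (l : List (Σ i, G i)), IsReducedList φ l ∧ (∀ p ∈ l, p.2 ∈ K p.1) ∧
        of i k * y = base φ c * listProd φ l := by
    rintro i k hk _ ⟨c, l, hl, hlK, rfl⟩
    obtain ⟨d, m, hm, hmK, -, h⟩ := hl.exists_of_mul hK hlK c hk
    exact ⟨d, m, hm, hmK, h⟩
  induction hx using Subgroup.closure_induction_left with
  | one => exact ⟨1, [], .nil, by simp, by simp⟩
  | mul_left y hy z _ ih =>
    obtain ⟨i, k, hk, rfl⟩ := Set.mem_iUnion.1 hy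
    exact step hk ih
  | inv_mul_cancel y hy z _ ih =>
    obtain ⟨i, k, hk, rfl⟩ := Set.mem_iUnion.1 hy
    rw [← map_inv]
    exact step (inv_mem hk) ih

theorem exists_listProd_eq [Nonempty ι] (x : PushoutI φ) : ∃ l, listProd φ l = x := by
  induction x using PushoutI.induction_on with
  | of i g => exact ⟨[⟨i, g⟩], by simp⟩
  | base c =>
    obtain ⟨i⟩ := ‹Nonempty ι›
    exact ⟨[⟨i, φ i c⟩], by simp [of_apply_eq_base]⟩
  | mul x y hx hy =>
    obtain ⟨l, rfl⟩ := hx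
    obtain ⟨m, rfl⟩ := hy
    exact ⟨l ++ m, by simp⟩

theorem HasBoundedPowers.conj [Nonempty ι] {x : PushoutI φ} (hx : HasBoundedPowers φ x)
    (w : PushoutI φ) : HasBoundedPowers φ (w * x * w⁻¹) := by
  obtain ⟨N, hN⟩ := hx
  obtain ⟨u, rfl⟩ := exists_listProd_eq w
  refine ⟨u.length + N + (invList u).length, fun n => ?_⟩
  obtain ⟨l, hl, h⟩ := hN n
  refine ⟨u ++ l ++ invList u, by simp; lia, ?_⟩
  rw [conj_pow]
  simp [listProd_invList, h, mul_assoc]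

theorem hasBoundedPowers_of (i : ι) (g : G i) : HasBoundedPowers φ (of i g) :=
  ⟨1, fun n => ⟨[⟨i, g ^ n⟩], by simp, by simp⟩⟩

/-- A reduced list whose first and last letters come from distinct factors spells an element
whose powers have unbounded length. -/
theorem IsReducedList.not_hasBoundedPowers (hφ : ∀ i, Function.Injective (φ i))
    {l : List (Σ i, G i)} (hl : IsReducedList φ l) (hne : l ≠ [])
    (h : ∀ p ∈ l.getLast?, ∀ q ∈ l.head?, p.1 ≠ q.1) : ¬ HasBoundedPowers φ (listProd φ l) := by
  rintro ⟨N, hN⟩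
  obtain ⟨m, hm, hmp⟩ := hN (N + 1)
  obtain ⟨c, m', hm', hlen, hmm'⟩ := exists_isReducedList_listProd (φ := φ) m
  have := (hl.flatten_replicate hne h (N + 1)).length_eq hφ hm' (c := 1) (d := c)
    (by rw [map_one, one_mul, listProd_flatten_replicate, ← hmp, hmm'])
  have hpos := List.length_pos_iff.2 hne
  simp only [List.length_flatten, List.map_replicate, List.sum_replicate, smul_eq_mul] at this
  nlinarith

/-- An element with bounded powers that is spelled with letters from the subgroups `K i` is
conjugate to an element of one of them. -/
theorem IsReducedList.exists_conj_of_hasBoundedPowers [Nonempty ι]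
    (hφ : ∀ i, Function.Injective (φ i)) {K : ∀ i, Subgroup (G i)}
    (hK : ∀ i, (φ i).range ≤ K i) (n : ℕ) :
    ∀ {l : List (Σ i, G i)} {c : C}, l.length ≤ n → IsReducedList φ l → (∀ p ∈ l, p.2 ∈ K p.1) →
      HasBoundedPowers φ (base φ c * listProd φ l) →
      ∃ j, ∃ k ∈ K j, ∃ w : PushoutI φ, base φ c * listProd φ l = w * of j k * w⁻¹ := by
  induction n with
  | zero =>
    intro l c hn _ _ _
    obtain rfl : l = [] := by simpa using hn
    obtain ⟨i⟩ := ‹Nonempty ι›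
    exact ⟨i, φ i c, hK i ⟨c, rfl⟩, 1, by simp [of_apply_eq_base]⟩
  | succ n ih =>
    intro l c hn hl hlK hbdd
    rcases l with _ | ⟨⟨i, a⟩, l⟩
    · exact ih (by simp) hl hlK hbdd
    have ha : a ∈ K i := hlK ⟨i, a⟩ (by simp)
    rcases l.eq_nil_or_concat with rfl | ⟨m, ⟨j, z⟩, rfl⟩
    · exact ⟨i, φ i c * a, mul_mem (hK i ⟨c, rfl⟩) ha, 1, by simp [of_apply_eq_base]⟩
    have hz : z ∈ K j := hlK ⟨j, z⟩ (by simp)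
    rw [List.concat_eq_append] at *
    by_cases hij : i = j
    · subst hij
      have hm : IsReducedList φ m := hl.tail.left_of_append
      have hmK : ∀ p ∈ m, p.2 ∈ K p.1 := fun p hp => hlK p (by simp [hp])
      have hconj : base φ c * listProd φ (⟨i, a⟩ :: (m ++ [⟨i, z⟩])) =
          (of i z)⁻¹ * (of i (z * φ i c * a) * listProd φ m) * (of i z)⁻¹⁻¹ := by
        simp [of_apply_eq_base, mul_assoc]
      have hrot : z * φ i c * a ∈ K i := mul_mem (mul_mem hz (hK i ⟨c, rfl⟩)) ha
      obtain ⟨d, m', hm', hm'K, hlen, h⟩ : ∃ (d : C) (m' : List (Σ i, G i)), IsReducedList φ m' ∧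
          (∀ p ∈ m', p.2 ∈ K p.1) ∧ m'.length ≤ m.length + 1 ∧
          of i (z * φ i c * a) * listProd φ m = base φ d * listProd φ m' := by
        simpa using hm.exists_of_mul hK hmK 1 hrot
      rw [hconj, h] at hbdd ⊢
      obtain ⟨j, k, hk, w, hw⟩ := ih (by simp at hn; lia) hm' hm'K
        (by simpa [mul_assoc] using hbdd.conj (of i z))
      exact ⟨j, k, hk, (of i z)⁻¹ * w, by rw [hw]; group⟩
    · have hred : IsReducedList φ (⟨i, φ i c * a⟩ :: (m ++ [⟨j, z⟩])) := by
        refine hl.replace_head fun h => hl.notMem_range ⟨i, a⟩ (by simp) ?_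
        exact ((φ i).range.mul_mem_cancel_left ⟨c, rfl⟩).1 h
      refine absurd ?_ (hred.not_hasBoundedPowers hφ (by simp) ?_)
      · simpa [of_apply_eq_base, mul_assoc] using hbdd
      · rw [← List.cons_append, List.getLast?_concat]
        simpa using Ne.symm hij

/-- The case of `of_conj` where the conjugator is spelled by a reduced list. -/
theorem IsReducedList.of_conj (hφ : ∀ i, Function.Injective (φ i)) {T : ∀ i, G i → Prop}
    (hconj : ∀ i (a x : G i), T i x → T i (a * x * a⁻¹)) (hbase : ∀ i c, T i (φ i c))
    {b : ι} {g : G b} {l : List (Σ i, G i)} (hl : IsReducedList φ l) :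
    ∀ {j : ι} {q : G j}, T j q →
      of b g = listProd φ l * of j q * (listProd φ l)⁻¹ → T b g := by
  induction l using List.reverseRecOn with
  | nil =>
    intro j q hq h
    simp only [listProd_nil, one_mul, inv_one, mul_one] at h
    by_cases hbj : b = j
    · subst hbj
      rwa [of_injective hφ b h]
    · have hmem : of b g ∈ (base φ).range := by
        rw [← inf_of_range_eq_base_range hφ hbj]
        exact ⟨⟨g, rfl⟩, ⟨q, h.symm⟩⟩
      obtain ⟨c, hc⟩ := hmem
      rw [← of_apply_eq_base φ b] at hc
      rw [← of_injective hφ b hc]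
      exact hbase b c
  | append_singleton l p ih =>
    obtain ⟨i, a⟩ := p
    intro j q hq h
    by_cases hij : i = j
    · subst hij
      exact ih hl.left_of_append (hconj i a q hq) (by simpa [mul_assoc] using h)
    by_cases hqr : q ∈ (φ j).range
    · obtain ⟨c, rfl⟩ := hqr
      refine ih hl.left_of_append (hconj i a _ (hbase i c)) ?_
      simpa [of_apply_eq_base, mul_assoc] using h
    have hq' : IsReducedList φ [⟨j, q⟩] := ⟨List.isChain_singleton _, by simpa using hqr⟩
    have hlq := hl.append hq' (by simpa using hij)
    have hbig := hlq.append hl.invList (by simpa [PushoutI.invList] using Ne.symm hij)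
    obtain ⟨c, m, hm, hlen, hmp⟩ := exists_isReducedList_listProd (φ := φ) [⟨b, g⟩]
    have := hbig.length_eq hφ hm (c := 1) (d := c) (by
      rw [← hmp, listProd_append, listProd_append, listProd_invList]
      simpa using h.symm)
    simp [PushoutI.invList] at this hlen
    lia

/-- A family `T` of conjugation-invariant predicates on the factors which hold on the image of the
base group is invariant under conjugation in the pushout. -/
theorem of_conj (hφ : ∀ i, Function.Injective (φ i)) {T : ∀ i, G i → Prop}
    (hconj : ∀ i (a x : G i), T i x → T i (a * x * a⁻¹)) (hbase : ∀ i c, T i (φ i c))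
    {b j : ι} {g : G b} {q : G j} (hq : T j q) (w : PushoutI φ)
    (h : of b g = w * of j q * w⁻¹) : T b g := by
  have : Nonempty ι := ⟨b⟩
  obtain ⟨u, rfl⟩ := exists_listProd_eq w
  obtain ⟨c, l, hl, -, hu⟩ := exists_isReducedList_listProd (φ := φ) u
  rw [hu] at h
  have := hl.of_conj hφ hconj hbase (b := b) (g := (φ b c)⁻¹ * g * φ b c) hq
    (by simp [h, of_apply_eq_base, mul_assoc])
  simpa [mul_assoc] using hconj b (φ b c) _ this

end

end Monoid.PushoutI

/-- Theorem 1.4(2) (Amalgamated Product, conjugacy): let `G = G₁ ∗_C G₂` be the amalgamated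
product of `∂₁ : C → G₁` and `∂₂ : C → G₂` (here the pair `G₁, G₂` is encoded as a
`Bool`-indexed family `Gs`), let `𝓗 i` be a finite collection of subgroups of `Gs i` and
`K i ≤ Gs i` with `φ i (C) ≤ K i`, and let
`𝓗 = ι₁(𝓗₁) ∪ ι₂(𝓗₂) ∪ {⟨ι₁(K₁) ∪ ι₂(K₂)⟩}`. Then `g ∈ Gs i` is conjugate in `Gs i` to an
element of some `Q ∈ 𝓗 i ∪ {K i}` iff `ι i g` is conjugate in `G` to an element of some
`H ∈ 𝓗`. -/
theorem amalgamated_conjugacy {C₀ : Type*} [Group C₀]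
    {Gs : Bool → Type*} [∀ b, Group (Gs b)]
    (𝓗 : ∀ b, Finset (Subgroup (Gs b))) (K : ∀ b, Subgroup (Gs b))
    (φ : ∀ b, C₀ →* Gs b)
    (hinj : ∀ b, Function.Injective (φ b))
    (hK : ∀ b, (φ b).range ≤ K b) :
    ∀ (b : Bool) (g : Gs b),
      (∃ Q : Subgroup (Gs b), (Q ∈ 𝓗 b ∨ Q = K b) ∧
        ∃ h ∈ Q, ∃ w : Gs b, g = w * h * w⁻¹) ↔
      (∃ H : Subgroup (PushoutI φ),
        (H ∈ (fun Q => Subgroup.map (PushoutI.of (φ := φ) true) Q) '' ↑(𝓗 true) ∪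
             (fun Q => Subgroup.map (PushoutI.of (φ := φ) false) Q) '' ↑(𝓗 false) ∨
         H = Subgroup.closure
              ((PushoutI.of (φ := φ) true) '' ↑(K true) ∪
               (PushoutI.of (φ := φ) false) '' ↑(K false))) ∧
        ∃ h ∈ H, ∃ w : PushoutI φ, PushoutI.of (φ := φ) b g = w * h * w⁻¹) := by
  let T : ∀ b, Gs b → Prop := fun b g => ∃ Q : Subgroup (Gs b), (Q ∈ 𝓗 b ∨ Q = K b) ∧
    ∃ h ∈ Q, ∃ w : Gs b, g = w * h * w⁻¹
  have hT : ∀ i (a x : Gs i), T i x → T i (a * x * a⁻¹) := by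
    rintro i a _ ⟨Q, hQ, h, hh, w, rfl⟩
    exact ⟨Q, hQ, h, hh, a * w, by group⟩
  have mem_T : ∀ {i} {Q : Subgroup (Gs i)}, (Q ∈ 𝓗 i ∨ Q = K i) → ∀ {x}, x ∈ Q → T i x :=
    fun hQ x hx => ⟨_, hQ, x, hx, 1, by simp⟩
  have hbase : ∀ i c, T i (φ i c) := fun i c => mem_T (.inr rfl) (hK i ⟨c, rfl⟩)
  intro b g
  constructor
  · rintro ⟨Q, hQ | rfl, h, hh, w, rfl⟩
    · refine ⟨Q.map (PushoutI.of b), .inl ?_, PushoutI.of b h, ⟨h, hh, rfl⟩, PushoutI.of b w,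
        by simp⟩
      cases b
      · exact .inr ⟨Q, hQ, rfl⟩
      · exact .inl ⟨Q, hQ, rfl⟩
    · refine ⟨_, .inr rfl, PushoutI.of b h, Subgroup.subset_closure ?_, PushoutI.of b w, by simp⟩
      cases b
      · exact .inr ⟨h, hh, rfl⟩
      · exact .inl ⟨h, hh, rfl⟩
  · rintro ⟨_, (⟨Q, hQ, rfl⟩ | ⟨Q, hQ, rfl⟩) | rfl, h, hh, w, hg⟩
    · obtain ⟨q, hq, rfl⟩ := hh
      exact PushoutI.of_conj hinj hT hbase (mem_T (.inl hQ) hq) w hg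
    · obtain ⟨q, hq, rfl⟩ := hh
      exact PushoutI.of_conj hinj hT hbase (mem_T (.inl hQ) hq) w hg
    · obtain ⟨c, l, hl, hlK, rfl⟩ := PushoutI.exists_isReducedList_of_mem_closure hK
        (by rwa [Set.union_eq_iUnion, Set.iUnion_congr (t := fun b =>
          PushoutI.of (φ := φ) b '' (K b : Set (Gs b))) (by rintro (_ | _) <;> rfl)] at hh)
      have hbdd : PushoutI.HasBoundedPowers φ (PushoutI.base φ c * PushoutI.listProd φ l) := by
        have := (PushoutI.hasBoundedPowers_of (φ := φ) b g).conj w⁻¹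
        rw [hg] at this
        simpa [mul_assoc] using this
      obtain ⟨j, k, hk, v, hv⟩ :=
        hl.exists_conj_of_hasBoundedPowers hinj hK _ le_rfl hlK hbdd
      exact PushoutI.of_conj hinj hT hbase (mem_T (.inr rfl) hk) (w * v)
        (by rw [hg, hv]; group)
end

section
/- Let G be a group, 𝓗 a finite collection of subgroups of G, and K, L subgroups of G with K ≠ L. Let C ≤ K and let φ : C → G be an injective group homomorphism with φ(C) ≤ L. Let G∗_φ = ⟨G, t | tct⁻¹ = φ(c) for all c ∈ C⟩ be the HNN-extension, with canonical injection ι : G → G∗_φ and stable letter t. Then for each g ∈ G, the element g is conjugate in G to an element of some Q ∈ 𝓗 ∪ {K, L} if and only if ι(g) is conjugate in G∗_φ to an element of some H ∈ {ι(H') : H' ∈ 𝓗} ∪ {⟨t·ι(K)·t⁻¹ ∪ ι(L)⟩}. -/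
namespace HNNExtension

open NormalWord
open scoped Pointwise

variable {G : Type*} [Group G] {A B : Subgroup G} (φ : A ≃* B) (K L : Subgroup G)

/-- The left coset of `K` or `L` recording the first edge, in the tree with vertex groups `G` and
`⟨tKt⁻¹ ∪ L⟩` and edge groups `K` and `L`, of the path from the base vertex determined by a reduced
word. -/
def NormalWord.ReducedWord.edgeCoset (w : ReducedWord G A B) : Set G :=
  w.head • (if w.toList.head?.map Prod.fst = some (-1) then (K : Set G) else (L : Set G))

theorem exists_reducedWord_prod_eq (x : HNNExtension G A B φ) :
    ∃ w : ReducedWord G A B, w.prod φ = x := by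
  obtain ⟨d⟩ := TransversalPair.nonempty G A B
  exact ⟨(x • (empty : NormalWord d)).toReducedWord, by simp⟩

/-- The coset `ReducedWord.edgeCoset` of any reduced word representing `x`. -/
noncomputable def edgeCoset (x : HNNExtension G A B φ) : Set G :=
  (exists_reducedWord_prod_eq φ x).choose.edgeCoset K L

variable {K L}

theorem NormalWord.ReducedWord.edgeCoset_eq_of_prod_eq (hA : A ≤ K) (hB : B ≤ L) {w₁ w₂ : ReducedWord G A B}
    (h : w₁.prod φ = w₂.prod φ) : w₁.edgeCoset K L = w₂.edgeCoset K L := by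
  obtain ⟨hl, hh⟩ := ReducedWord.map_fst_eq_and_of_prod_eq φ h
  have hl' : w₁.toList.head?.map Prod.fst = w₂.toList.head?.map Prod.fst := by
    simpa using congrArg List.head? hl
  unfold ReducedWord.edgeCoset
  rw [← hl']
  rcases hw : w₁.toList.head?.map Prod.fst with _ | u
  · have h₁ : w₁.toList = [] := by simpa using hw
    have h₂ : w₂.toList = [] := by simpa [hw] using hl'.symm
    have : w₁.head = w₂.head := of_injective φ (by simpa [ReducedWord.prod, h₁, h₂] using h)
    rw [this]
  · have hu := hh u hw
    rcases Int.units_eq_one_or u with rfl | rfl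
    · simpa [leftCoset_eq_iff] using hB hu
    · simpa [leftCoset_eq_iff] using hA hu

theorem edgeCoset_prod (hA : A ≤ K) (hB : B ≤ L) (w : ReducedWord G A B) :
    edgeCoset φ K L (w.prod φ) = w.edgeCoset K L :=
  ReducedWord.edgeCoset_eq_of_prod_eq φ hA hB (exists_reducedWord_prod_eq φ (w.prod φ)).choose_spec

theorem edgeCoset_eq_of_eq_prod (hA : A ≤ K) (hB : B ≤ L) {x : HNNExtension G A B φ}
    (w : ReducedWord G A B) (h : x = w.prod φ) : edgeCoset φ K L x = w.edgeCoset K L := by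
  rw [h, edgeCoset_prod φ hA hB]

theorem exists_edgeCoset_eq (x : HNNExtension G A B φ) :
    ∃ a : G, edgeCoset φ K L x = a • (K : Set G) ∨ edgeCoset φ K L x = a • (L : Set G) := by
  unfold edgeCoset ReducedWord.edgeCoset
  split_ifs
  exacts [⟨_, .inl rfl⟩, ⟨_, .inr rfl⟩]

theorem edgeCoset_of_mul (hA : A ≤ K) (hB : B ≤ L) (g : G) (x : HNNExtension G A B φ) :
    edgeCoset φ K L (of g * x) = g • edgeCoset φ K L x := by
  obtain ⟨w, rfl⟩ := exists_reducedWord_prod_eq φ x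
  rw [edgeCoset_prod φ hA hB,
    edgeCoset_eq_of_eq_prod φ hA hB { w with head := g * w.head }
      (by simp [ReducedWord.prod, mul_assoc])]
  simp [ReducedWord.edgeCoset, mul_smul]

/-- The last syllable of a reduced word may be multiplied on the right by any element of `G`. -/
theorem edgeCoset_mul_of_of_notMem (hA : A ≤ K) (hB : B ≤ L) {x : HNNExtension G A B φ}
    (hx : x ∉ (of (φ := φ)).range) (g : G) :
    edgeCoset φ K L (x * of g) = edgeCoset φ K L x := by
  obtain ⟨⟨h, l, hl⟩, rfl⟩ := exists_reducedWord_prod_eq φ x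
  rcases List.eq_nil_or_concat' l with rfl | ⟨l, ⟨u, a⟩, rfl⟩
  · exact absurd ⟨h, by simp [ReducedWord.prod]⟩ hx
  · rw [edgeCoset_prod φ hA hB,
      edgeCoset_eq_of_eq_prod φ hA hB ⟨h, l ++ [(u, a * g)], by
        simpa [List.isChain_append] using hl⟩ (by simp [ReducedWord.prod, mul_assoc])]
    cases l <;> simp [ReducedWord.edgeCoset]

theorem edgeCoset_mul_of (hA : A ≤ K) (hB : B ≤ L) (x : HNNExtension G A B φ) {l : G}
    (hl : l ∈ L) : edgeCoset φ K L (x * of l) = edgeCoset φ K L x := by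
  by_cases hx : x ∈ (of (φ := φ)).range
  · obtain ⟨a, rfl⟩ := hx
    rw [← map_mul,
      edgeCoset_eq_of_eq_prod φ hA hB ⟨a * l, [], .nil⟩ (by simp [ReducedWord.prod]),
      edgeCoset_eq_of_eq_prod φ hA hB ⟨a, [], .nil⟩ (by simp [ReducedWord.prod])]
    simp [ReducedWord.edgeCoset, leftCoset_eq_iff, hl]
  · exact edgeCoset_mul_of_of_notMem φ hA hB hx l

theorem edgeCoset_mul_of_mul_inv_t (hA : A ≤ K) (hB : B ≤ L) (x : HNNExtension G A B φ) {k : G}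
    (hk : k ∈ K) :
    edgeCoset φ K L (x * of k * t⁻¹) = edgeCoset φ K L (x * t⁻¹) := by
  obtain ⟨⟨h, l, hl⟩, rfl⟩ := exists_reducedWord_prod_eq φ x
  rcases List.eq_nil_or_concat' l with rfl | ⟨l, ⟨u, a⟩, rfl⟩
  · rw [edgeCoset_eq_of_eq_prod φ hA hB ⟨h * k, [(-1, 1)], by simp⟩ (by simp [ReducedWord.prod]),
      edgeCoset_eq_of_eq_prod φ hA hB ⟨h, [(-1, 1)], by simp⟩ (by simp [ReducedWord.prod])]
    simp [ReducedWord.edgeCoset, leftCoset_eq_iff, hk]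
  have reduced : ∀ b : G, (b ∈ toSubgroup A B u → u = -1) →
      edgeCoset φ K L
        (of h * (l.map fun x => t ^ (x.1 : ℤ) * of x.2).prod * (t ^ (u : ℤ) * of b) * t⁻¹) =
      h • (if (l ++ [(u, a)]).head?.map Prod.fst = some (-1) then (K : Set G) else L) := by
    intro b hb
    rw [edgeCoset_eq_of_eq_prod φ hA hB ⟨h, l ++ [(u, b)] ++ [(-1, 1)], by
      rw [List.isChain_append] at hl ⊢
      rw [List.isChain_append]
      simpa [hl.1] using ⟨by simpa using hl.2.2, hb⟩⟩ (by simp [ReducedWord.prod, mul_assoc])]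
    cases l <;> simp [ReducedWord.edgeCoset]
  have expand : ∀ b : G, ReducedWord.prod φ ⟨h, l ++ [(u, a)], hl⟩ * of b * t⁻¹ =
      of h * (l.map fun x => t ^ (x.1 : ℤ) * of x.2).prod * (t ^ (u : ℤ) * of (a * b)) * t⁻¹ := by
    intro b
    simp [ReducedWord.prod, mul_assoc]
  have expand_one := expand 1
  rw [map_one, mul_one, mul_one] at expand_one
  rw [expand, expand_one]
  rcases Int.units_eq_one_or u with rfl | rfl
  · by_cases ha : a ∈ K
    · have hl' : l.IsChain fun a b => a.2 ∈ toSubgroup A B a.1 → a.1 = b.1 :=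
        (List.isChain_append.1 hl).1
      suffices ∀ b ∈ K, edgeCoset φ K L (of h * (l.map fun x => t ^ (x.1 : ℤ) * of x.2).prod *
          (t ^ ((1 : ℤˣ) : ℤ) * of b) * t⁻¹) = ReducedWord.edgeCoset K L ⟨h, l, hl'⟩ by
        rw [this _ (mul_mem ha hk), this _ ha]
      intro b hb
      by_cases hbA : b ∈ A
      · rw [← edgeCoset_prod φ hA hB,
          ← edgeCoset_mul_of φ hA hB (ReducedWord.prod φ ⟨h, l, hl'⟩) (hB (φ ⟨b, hbA⟩).2),
          equiv_eq_conj]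
        simp [ReducedWord.prod, mul_assoc]
      · rw [reduced b (by simp [hbA])]
        cases l <;> simp [ReducedWord.edgeCoset]
    · rw [reduced a fun h => absurd (hA h) ha,
        reduced (a * k) fun h => absurd ((K.mul_mem_cancel_right hk).1 (hA h)) ha]
  · rw [reduced _ fun _ => rfl, reduced _ fun _ => rfl]

theorem edgeCoset_mul_of_mem_closure (hA : A ≤ K) (hB : B ≤ L) (x : HNNExtension G A B φ)
    {m : HNNExtension G A B φ}
    (hm : m ∈ Subgroup.closure ((fun x : G => t * of x * t⁻¹) '' (K : Set G) ∪
      of (φ := φ) '' (L : Set G))) :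
    edgeCoset φ K L (x * m) = edgeCoset φ K L x := by
  induction hm using Subgroup.closure_induction generalizing x with
  | mem y hy =>
    rcases hy with ⟨k, hk, rfl⟩ | ⟨l, hl, rfl⟩
    · have h := edgeCoset_mul_of_mul_inv_t φ hA hB (x * (t : HNNExtension G A B φ)) hk
      simpa only [mul_assoc, mul_inv_cancel, mul_one] using h
    · exact edgeCoset_mul_of φ hA hB x hl
  | one => simp
  | mul y z _ _ hy hz => rw [← mul_assoc, hz, hy]
  | inv y _ hy => simpa using (hy (x * y⁻¹)).symm

theorem exists_conj_mem_of_edgeCoset_mul_eq (hA : A ≤ K) (hB : B ≤ L) {g : G}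
    {x : HNNExtension G A B φ} (h : edgeCoset φ K L (of g * x) = edgeCoset φ K L x) :
    ∃ Q : Subgroup G, (Q = K ∨ Q = L) ∧ ∃ h ∈ Q, ∃ w : G, g = w * h * w⁻¹ := by
  rw [edgeCoset_of_mul φ hA hB] at h
  have key : ∀ (Q : Subgroup G) (a : G), g • a • (Q : Set G) = a • (Q : Set G) →
      ∃ h ∈ Q, ∃ w : G, g = w * h * w⁻¹ := fun Q a hQ =>
    ⟨a⁻¹ * g * a, by
      rw [← mul_smul] at hQ
      simpa [mul_assoc] using (leftCoset_eq_iff Q).1 hQ.symm, a, by group⟩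
  obtain ⟨a, ha | ha⟩ := exists_edgeCoset_eq (K := K) (L := L) φ x
  · exact ⟨K, .inl rfl, key K a (by rwa [ha] at h)⟩
  · exact ⟨L, .inr rfl, key L a (by rwa [ha] at h)⟩

end HNNExtension


/-- Theorem 1.5(2) (HNN-extension, conjugacy): let `G∗_φ` be the HNN-extension of `G` along
the injective homomorphism `φ : C → G` with `C ≤ K` and `φ(C) ≤ L`, with stable letter `t`
and canonical injection `ι`. Then `g ∈ G` is conjugate in `G` to an element of some
`Q ∈ 𝓗 ∪ {K, L}` iff `ι g` is conjugate in `G∗_φ` to an element of some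
`H ∈ {ι(H') : H' ∈ 𝓗} ∪ {⟨t·ι(K)·t⁻¹ ∪ ι(L)⟩}`. -/
theorem hnn_conjugacy {G : Type*} [Group G]
    (𝓗 : Finset (Subgroup G)) (K L : Subgroup G) (hKL : K ≠ L)
    (C : Subgroup G) (hCK : C ≤ K) (φ : C →* G)
    (hφinj : Function.Injective φ) (hφL : φ.range ≤ L) :
    ∀ g : G,
      (∃ Q : Subgroup G, (Q ∈ 𝓗 ∨ Q = K ∨ Q = L) ∧
        ∃ h ∈ Q, ∃ w : G, g = w * h * w⁻¹) ↔
      (∃ H : Subgroup (HNNExtension G C φ.range (MonoidHom.ofInjective hφinj)),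
        (H ∈ (fun Q : Subgroup G =>
            Subgroup.map (HNNExtension.of (φ := MonoidHom.ofInjective hφinj)) Q) '' ↑𝓗 ∨
          H = Subgroup.closure
            ((fun x : G => HNNExtension.t * HNNExtension.of x * HNNExtension.t⁻¹) '' ↑K ∪
              (HNNExtension.of (φ := MonoidHom.ofInjective hφinj)) '' ↑L)) ∧
        ∃ h ∈ H, ∃ w : HNNExtension G C φ.range (MonoidHom.ofInjective hφinj),
          HNNExtension.of g = w * h * w⁻¹) := by
  intro g
  constructor
  · rintro ⟨Q, hQ | rfl | rfl, h, hh, w, rfl⟩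
    · exact ⟨_, .inl ⟨Q, hQ, rfl⟩, _, Subgroup.mem_map_of_mem _ hh, .of w, by simp⟩
    · exact ⟨_, .inr rfl, _, Subgroup.subset_closure (.inl ⟨h, hh, rfl⟩),
        .of w * HNNExtension.t⁻¹, by simp [mul_assoc]⟩
    · exact ⟨_, .inr rfl, _, Subgroup.subset_closure (.inr ⟨h, hh, rfl⟩), .of w, by simp⟩
  · rintro ⟨_, ⟨Q, hQ, rfl⟩ | rfl, m, hm, w, hw⟩
    · obtain ⟨h, hh, rfl⟩ := hm
      by_cases hwG : w ∈ (HNNExtension.of (φ := MonoidHom.ofInjective hφinj)).range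
      · obtain ⟨a, rfl⟩ := hwG
        exact ⟨Q, .inl hQ, h, hh, a, HNNExtension.of_injective _ (by simpa using hw)⟩
      · obtain ⟨S, hS, hgS⟩ := HNNExtension.exists_conj_mem_of_edgeCoset_mul_eq _ hCK hφL
          (g := g) (x := w) (by
            rw [hw, inv_mul_cancel_right,
              HNNExtension.edgeCoset_mul_of_of_notMem _ hCK hφL hwG])
        exact ⟨S, .inr hS, hgS⟩
    · obtain ⟨S, hS, hgS⟩ := HNNExtension.exists_conj_mem_of_edgeCoset_mul_eq _ hCK hφL
        (g := g) (x := w) (by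
          rw [hw, inv_mul_cancel_right,
            HNNExtension.edgeCoset_mul_of_mem_closure _ hCK hφL _ hm])
      exact ⟨S, .inr hS, hgS⟩
end
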